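/- Let λ ∈ (0,1); let μ ≠ δ₀ be a symmetric Borel probability measure on ℝ that is ⊞_λ-infinitely divisible with rectangular R-transform C, and let ν, ρ be symmetric Borel probability measures on ℝ such that ρ is the rectangular free convolution μ ⊞_λ ν. Then for every x ∈ (0,+∞), the limits lim_{z→x, z∈ℂ⁺} M_ρ(z) and lim_{z→x, z∈ℂ⁺} H_ρ(z) exist in ℂ ∪ {∞}, and the first of these limits belongs to ℂ⁺ ∪ ℝ ∪ {∞}. -/

import Mathlib

open MeasureTheory Complex Set Filter Topology

noncomputable section

/-- The upper half-plane. -/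
def UHP : Set ℂ := {z : ℂ | 0 < z.im}

/-- The nonnegative real axis, viewed as a subset of `ℂ`. -/
def posAxis : Set ℂ := {z : ℂ | z.im = 0 ∧ 0 ≤ z.re}

/-- `M_μ(z) = ∫ z t² / (1 - z t²) dμ(t)`. -/
def Mt (μ : Measure ℝ) (z : ℂ) : ℂ := ∫ t : ℝ, z * (t : ℂ) ^ 2 / (1 - z * (t : ℂ) ^ 2) ∂μ

/-- `H_μ(z) = z (1 + M_μ(z)) (1 + λ M_μ(z))`. -/
def Ht (l : ℝ) (μ : Measure ℝ) (z : ℂ) : ℂ :=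
  z * (1 + Mt μ z) * (1 + (l : ℂ) * Mt μ z)

/-- `T(w) = (λ w + 1)(w + 1)`. -/
def Tfun (l : ℝ) (w : ℂ) : ℂ := ((l : ℂ) * w + 1) * (w + 1)

/-- The rectangular `R`-transform with Lévy measure `G`:
`C(z) = z ∫ (1+t²)/(1-z t²) dG(t)`. -/
def rectC (G : Measure ℝ) (z : ℂ) : ℂ :=
  z * ∫ t : ℝ, (1 + (t : ℂ) ^ 2) / (1 - z * (t : ℂ) ^ 2) ∂G

/-- `μ` is `⊞_λ`-infinitely divisible with rectangular `R`-transform `C = rectC G`: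
`H_μ(x) = x T(C(H_μ(x)))` for `x < 0` close to `0`. -/
def IsRectInfDiv (l : ℝ) (μ G : Measure ℝ) : Prop :=
  ∃ ε > (0 : ℝ), ∀ x ∈ Set.Ioo (-ε) (0 : ℝ),
    Ht l μ (x : ℂ) = (x : ℂ) * Tfun l (rectC G (Ht l μ (x : ℂ)))

/-- `ρ` is the rectangular free convolution `μ ⊞_λ ν`, where `μ` has rectangular
`R`-transform `rectC G`. -/
def IsRectConv (l : ℝ) (G ν ρ : Measure ℝ) : Prop :=
  ∃ ε > (0 : ℝ), ∀ x ∈ Set.Ioo (-ε) (0 : ℝ),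
    Tfun l (Mt ρ (x : ℂ) - rectC G (Ht l ρ (x : ℂ))) ≠ 0 ∧
    Ht l ρ (x : ℂ) =
      Ht l ν (Ht l ρ (x : ℂ) / Tfun l (Mt ρ (x : ℂ) - rectC G (Ht l ρ (x : ℂ))))

lemma UHP_open : IsOpen UHP := isOpen_lt continuous_const Complex.continuous_im

lemma halfplane_max {g : ℂ → ℂ} (hg : DifferentiableOn ℂ g UHP) (B : ℝ)
    (hB : ∀ w ∈ UHP, ‖g w‖ ≤ B) (η : ℝ) (hη : 0 < η) (C : ℝ)
    (hC : ∀ t : ℝ, ‖g (t + η * I)‖ ≤ C) (w : ℂ) (hw : η ≤ w.im) : ‖g w‖ ≤ C := by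
  have hmap : ∀ ζ : ℂ, 0 ≤ ζ.re → I * ζ + η * I ∈ UHP := by
    intro ζ hζ
    simp only [UHP, mem_ofPred_eq, add_im, mul_im, I_re, I_im, ofReal_re, ofReal_im]
    linarith
  have h1 : DifferentiableOn ℂ (fun ζ : ℂ => g (I * ζ + η * I)) {z | -η < z.re} := by
    apply hg.comp
    · fun_prop
    · intro ζ hζ
      simp only [UHP, mem_ofPred_eq, add_im, mul_im, I_re, I_im, ofReal_re, ofReal_im] at *
      linarith
  have h2 : DiffContOnCl ℂ (fun ζ : ℂ => g (I * ζ + η * I)) {z | 0 < z.re} := by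
    refine (DifferentiableOn.mono h1 ?_).diffContOnCl
    intro ζ hζ
    have : ζ ∈ {z : ℂ | 0 ≤ z.re} :=
      closure_minimal (s := {z : ℂ | 0 < z.re}) (t := {z : ℂ | 0 ≤ z.re})
        (by intro z hz; simp only [mem_ofPred_eq] at *; exact hz.le)
        (isClosed_le continuous_const Complex.continuous_re) hζ
    simp only [mem_ofPred_eq] at *
    linarith
  have := PhragmenLindelof.right_half_plane_of_bounded_on_real (z := -I * (w - η * I)) (C := C) h2
    ⟨1, by norm_num, 0, ?_⟩ ?_ ?_ ?_
  · have e : I * (-I * (w - η * I)) + η * I = w := by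
      linear_combination (-(w - η * I)) * I_mul_I
    simp only [e] at this
    exact this
  · apply Asymptotics.IsBigO.of_bound B
    rw [eventually_inf_principal]
    refine Eventually.of_forall fun ζ hζ => ?_
    simp only [zero_mul, Real.exp_zero, norm_one, mul_one]
    exact hB _ (hmap ζ (le_of_lt hζ))
  · refine ⟨B, ?_⟩
    rw [eventually_map]
    filter_upwards [eventually_ge_atTop 0] with t ht
    exact hB _ (hmap _ (by simpa using ht))
  · intro t
    have := hC (-t)
    have e : I * (t * I) + η * I = ((-t : ℝ) : ℂ) + η * I := by
      push_cast
      linear_combination (t : ℂ) * I_mul_I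
    simp only [e]
    exact this
  · simp
    linarith

lemma poisson_integrable (x y : ℝ) (hy : 0 < y) :
    Integrable (fun s : ℝ => y / ((s - x) ^ 2 + y ^ 2)) ∧
    ∫ s : ℝ, y / ((s - x) ^ 2 + y ^ 2) = Real.pi := by
  have e : (fun s : ℝ => y / ((s - x) ^ 2 + y ^ 2)) =
      fun s : ℝ => y⁻¹ * (1 + ((s - x) / y) ^ 2)⁻¹ := by
    funext s
    have : 0 < (s - x) ^ 2 + y ^ 2 := by positivity
    field_simp
    ring
  rw [e]
  constructor
  · apply Integrable.const_mul
    have := (integrable_inv_one_add_sq).comp_div hy.ne'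
    exact this.comp_sub_right x
  · rw [integral_const_mul]
    have h1 := integral_sub_right_eq_self (fun s : ℝ => (1 + (s / y) ^ 2)⁻¹) x (μ := volume)
    rw [h1]
    have h2 := Measure.integral_comp_div (fun s : ℝ => (1 + s ^ 2)⁻¹) y
    rw [h2, integral_univ_inv_one_add_sq, abs_of_pos hy, smul_eq_mul]
    field_simp

lemma green_sum {ι : Type*} (u : Finset ι) (W : ι → ℂ) (hW : ∀ i ∈ u, 0 < (W i).im)
    (hdis : (u : Set ι).PairwiseDisjoint fun i => Metric.closedBall (W i).re (W i).im)
    (h : ℂ) (hh : 0 < h.im) (hfar : ∀ i ∈ u, (W i).im / 8 ≤ ‖h - W i‖) :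
    ∑ i ∈ u, 4 * (W i).im * h.im / ‖h - W i‖ ^ 2 ≤ 2000 := by
  obtain ⟨hintg, hval⟩ := poisson_integrable h.re h.im hh
  have key : ∀ i ∈ u, 4 * (W i).im * h.im / ‖h - W i‖ ^ 2 ≤
      578 * ∫ s in Metric.closedBall (W i).re (W i).im, h.im / ((s - h.re) ^ 2 + h.im ^ 2) := by
    intro i hi
    have hy := hW i hi
    have hf := hfar i hi
    have hpos : 0 < ‖h - W i‖ := by linarith [div_pos hy (by norm_num : (0:ℝ) < 8)]
    have hlow : ∀ s ∈ Metric.closedBall (W i).re (W i).im,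
        h.im / (289 * ‖h - W i‖ ^ 2) ≤ h.im / ((s - h.re) ^ 2 + h.im ^ 2) := by
      intro s hs
      rw [Metric.mem_closedBall, Real.dist_eq] at hs
      have e : (s - h.re) ^ 2 + h.im ^ 2 = ‖(s : ℂ) - h‖ ^ 2 := by
        rw [← normSq_eq_norm_sq, normSq_apply]; simp; ring
      have t1 : ‖(s : ℂ) - h‖ ≤ 17 * ‖h - W i‖ := by
        have a1 : ‖(s : ℂ) - h‖ ≤ ‖(s : ℂ) - W i‖ + ‖W i - h‖ := by
          simpa using norm_add_le ((s : ℂ) - W i) (W i - h)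
        have a2 : ‖(s : ℂ) - W i‖ ≤ 2 * (W i).im := by
          refine (Complex.norm_le_abs_re_add_abs_im _).trans ?_
          simp [abs_of_pos hy]
          linarith
        rw [norm_sub_rev (W i) h] at a1
        linarith
      have hpos2 : 0 < (s - h.re) ^ 2 + h.im ^ 2 := by positivity
      apply div_le_div_of_nonneg_left hh.le hpos2
      rw [e]
      nlinarith [norm_nonneg ((s : ℂ) - h)]
    have hmono := setIntegral_mono_on (μ := volume)
      (s := Metric.closedBall (W i).re (W i).im)
      (f := fun _ => h.im / (289 * ‖h - W i‖ ^ 2))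
      (g := fun s => h.im / ((s - h.re) ^ 2 + h.im ^ 2))
      (by
        apply integrableOn_const
        · rw [Real.volume_closedBall]; exact ENNReal.ofReal_ne_top
        · exact enorm_ne_top)
      hintg.integrableOn Metric.isClosed_closedBall.measurableSet hlow
    rw [setIntegral_const, measureReal_def, Real.volume_closedBall,
      ENNReal.toReal_ofReal (by linarith), smul_eq_mul] at hmono
    refine le_trans (le_of_eq ?_) (mul_le_mul_of_nonneg_left hmono (by norm_num))
    field_simp
    norm_num
  have hsum : ∑ i ∈ u, ∫ s in Metric.closedBall (W i).re (W i).im,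
      h.im / ((s - h.re) ^ 2 + h.im ^ 2) ≤ Real.pi := by
    rw [← integral_biUnion_finset u (fun i _ => Metric.isClosed_closedBall.measurableSet) hdis
      (fun i _ => hintg.integrableOn), ← hval]
    apply setIntegral_le_integral hintg
    exact Eventually.of_forall fun s => by positivity
  calc _ ≤ ∑ i ∈ u, 578 * ∫ s in Metric.closedBall (W i).re (W i).im,
      h.im / ((s - h.re) ^ 2 + h.im ^ 2) := Finset.sum_le_sum key
    _ = 578 * ∑ i ∈ u, ∫ s in Metric.closedBall (W i).re (W i).im,
      h.im / ((s - h.re) ^ 2 + h.im ^ 2) := by rw [Finset.mul_sum]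
    _ ≤ 578 * Real.pi := by gcongr
    _ ≤ 2000 := by nlinarith [Real.pi_lt_d2]

lemma blaschke_sq (h w : ℂ) (hne : h ≠ w) :
    ‖(h - (starRingEnd ℂ) w) / (h - w)‖ ^ 2 = 1 + 4 * w.im * h.im / ‖h - w‖ ^ 2 := by
  have : ‖h - w‖ ≠ 0 := by rw [norm_ne_zero_iff]; exact sub_ne_zero.2 hne
  rw [norm_div, div_pow]
  field_simp
  rw [← normSq_eq_norm_sq, ← normSq_eq_norm_sq, normSq_apply, normSq_apply]
  simp
  ring

lemma prod_sq_eq {ι : Type*} (u : Finset ι) (W : ι → ℂ) (h : ℂ) (hne : ∀ i ∈ u, h ≠ W i) :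
    ‖∏ i ∈ u, (h - (starRingEnd ℂ) (W i)) / (h - W i)‖ ^ 2
      = ∏ i ∈ u, (1 + 4 * (W i).im * h.im / ‖h - W i‖ ^ 2) := by
  rw [norm_prod, ← Finset.prod_pow]
  exact Finset.prod_congr rfl fun i hi => blaschke_sq _ _ (hne i hi)

lemma prod_sq_le {ι : Type*} (u : Finset ι) (W : ι → ℂ) (hW : ∀ i ∈ u, 0 < (W i).im)
    (h : ℂ) (hh : 0 < h.im) (hne : ∀ i ∈ u, h ≠ W i) (K : ℝ)
    (hK : ∑ i ∈ u, 4 * (W i).im * h.im / ‖h - W i‖ ^ 2 ≤ K) :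
    ‖∏ i ∈ u, (h - (starRingEnd ℂ) (W i)) / (h - W i)‖ ^ 2 ≤ Real.exp K := by
  rw [prod_sq_eq u W h hne]
  refine le_trans ?_ (Real.exp_le_exp.2 hK)
  rw [Real.exp_sum]
  apply Finset.prod_le_prod
  · intro i hi
    have := hW i hi
    positivity
  · intro i hi
    rw [add_comm]
    exact Real.add_one_le_exp _

lemma prod_sq_ge {ι : Type*} (u : Finset ι) (a : ι → ℝ) (ha : ∀ i ∈ u, 0 ≤ a i) :
    1 + ∑ i ∈ u, a i ≤ ∏ i ∈ u, (1 + a i) := by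
  classical
  induction u using Finset.induction_on with
  | empty => simp
  | insert i s hi ih =>
    rw [Finset.sum_insert hi, Finset.prod_insert hi]
    have h1 := ih fun j hj => ha j (Finset.mem_insert_of_mem hj)
    have h2 := ha i (Finset.mem_insert_self _ _)
    have h3 : 0 ≤ ∑ j ∈ s, a j := Finset.sum_nonneg fun j hj => ha j (Finset.mem_insert_of_mem hj)
    nlinarith

lemma one_gen_core {ι : Type*} (u : Finset ι) (W : ι → ℂ) (hW : ∀ i ∈ u, 0 < (W i).im)
    (hW8 : ∀ i ∈ u, (W i).im < 1 / 8) (hWre : ∀ i ∈ u, |(W i).re| ≤ 5 / 8)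
    (hdis : (u : Set ι).PairwiseDisjoint fun i => Metric.closedBall (W i).re (W i).im)
    (hsum : 1 / 20 ≤ ∑ i ∈ u, (W i).im)
    {f : ℂ → ℂ} (hf : DifferentiableOn ℂ f UHP) (hf1 : ∀ w ∈ UHP, ‖f w‖ ≤ 1)
    (hfW : ∀ i ∈ u, ‖f (W i)‖ ≤ 1 / 4) : ‖f I‖ ≤ 1 - 1 / 44000 := by
  -- smallness of f on discs
  have hdisc : ∀ i ∈ u, ∀ h : ℂ, ‖h - W i‖ = (W i).im / 8 → ‖f h‖ ≤ 1 / 2 := by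
    intro i hi h hh
    have hy := hW i hi
    have hball : Metric.ball (W i) (W i).im ⊆ UHP := by
      intro z hz
      rw [Metric.mem_ball, dist_eq_norm] at hz
      have := (abs_le.1 (abs_im_le_norm (z - W i))).1
      simp only [sub_im] at this
      simp only [UHP, mem_ofPred_eq]
      linarith
    have hmaps : MapsTo f (Metric.ball (W i) (W i).im) (Metric.closedBall (f (W i)) 2) := by
      intro z hz
      rw [Metric.mem_closedBall, dist_eq_norm]
      have := norm_sub_le (f z) (f (W i))
      linarith [hf1 z (hball hz), hfW i hi]
    have hz : h ∈ Metric.ball (W i) (W i).im := by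
      rw [Metric.mem_ball, dist_eq_norm]; linarith
    have := Complex.dist_le_div_mul_dist_of_mapsTo_ball (hf.mono hball) hmaps hz
    rw [dist_eq_norm, dist_eq_norm, hh] at this
    have e : 2 / (W i).im * ((W i).im / 8) = 1 / 4 := by field_simp; norm_num
    rw [e] at this
    have h2 := norm_le_norm_add_norm_sub' (f h) (f (W i))
    linarith [hfW i hi]
  obtain ⟨ζ, hζ, hζf⟩ : ∃ ζ : ℂ, ‖ζ‖ = 1 ∧ ζ * f I = (‖f I‖ : ℂ) := by
    by_cases h0 : f I = 0
    · exact ⟨1, by simp, by simp [h0]⟩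
    · refine ⟨(‖f I‖ : ℂ) / f I, ?_, ?_⟩
      · rw [norm_div]; simp [h0]
      · field_simp
  set F : ℂ → ℂ := fun h => Complex.exp (-(2000 : ℂ) * (1 - ζ * f h)) *
    ∏ i ∈ u, (h - (starRingEnd ℂ) (W i)) / (h - W i) with hF
  have hFn : ∀ h, ‖F h‖ ^ 2 = Real.exp (-4000 * (1 - ζ * f h).re) *
      ‖∏ i ∈ u, (h - (starRingEnd ℂ) (W i)) / (h - W i)‖ ^ 2 := by
    intro h
    rw [hF]
    simp only [norm_mul, mul_pow, Complex.norm_exp]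
    rw [← Real.exp_nat_mul]
    congr 2
    simp
    ring
  have hre : ∀ h, ∀ c : ℝ, ‖f h‖ ≤ c → 1 - c ≤ (1 - ζ * f h).re := by
    intro h c hc
    have := re_le_norm (ζ * f h)
    rw [norm_mul, hζ] at this
    simp only [sub_re, one_re]
    linarith
  set K : ℝ := ∑ i ∈ u, 16 / (W i).im with hKdef
  have hK0 : 0 ≤ K := Finset.sum_nonneg fun i hi => by have := hW i hi; positivity
  have main : ∀ η : ℝ, 0 < η → η ≤ 1 / 4 → (∀ i ∈ u, η ≤ (W i).im / 2) →
      ‖F I‖ ^ 2 ≤ Real.exp (η * K) := by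
    intro η hη hη2 hηi
    set Ω : Set ℂ := {h : ℂ | η < h.im ∧ ‖h‖ < 1 / η ∧ ∀ i ∈ u, (W i).im / 8 < ‖h - W i‖} with hΩ
    set Γ : Set ℂ := {h : ℂ | η ≤ h.im ∧ ‖h‖ ≤ 1 / η ∧ ∀ i ∈ u, (W i).im / 8 ≤ ‖h - W i‖} with hΓ
    have hΩo : IsOpen Ω := by
      have : Ω = {h : ℂ | η < h.im} ∩ ({h : ℂ | ‖h‖ < 1 / η} ∩
          ⋂ i ∈ u, {h : ℂ | (W i).im / 8 < ‖h - W i‖}) := by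
        ext h; simp [hΩ]
      rw [this]
      refine (isOpen_lt continuous_const continuous_im).inter
        ((isOpen_lt continuous_norm continuous_const).inter ?_)
      exact isOpen_biInter_finset fun i _ => isOpen_lt continuous_const (by fun_prop)
    have hΓc : IsClosed Γ := by
      have : Γ = {h : ℂ | η ≤ h.im} ∩ ({h : ℂ | ‖h‖ ≤ 1 / η} ∩
          ⋂ i ∈ u, {h : ℂ | (W i).im / 8 ≤ ‖h - W i‖}) := by
        ext h; simp [hΓ]
      rw [this]
      refine (isClosed_le continuous_const continuous_im).inter
        ((isClosed_le continuous_norm continuous_const).inter ?_)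
      exact isClosed_biInter fun i _ => isClosed_le continuous_const (by fun_prop)
    have hcl : closure Ω ⊆ Γ := by
      apply closure_minimal _ hΓc
      intro h hh
      simp only [hΩ, hΓ, mem_ofPred_eq] at *
      exact ⟨hh.1.le, hh.2.1.le, fun i hi => (hh.2.2 i hi).le⟩
    have hΓU : Γ ⊆ UHP := by
      intro h hh
      simp only [hΓ, UHP, mem_ofPred_eq] at *
      linarith [hh.1]
    have hΓne : ∀ h ∈ Γ, ∀ i ∈ u, h ≠ W i := by
      intro h hh i hi he
      simp only [hΓ, mem_ofPred_eq] at hh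
      have := hh.2.2 i hi
      rw [he, sub_self, norm_zero] at this
      linarith [hW i hi]
    have hbd : Bornology.IsBounded Ω := by
      refine (Metric.isBounded_closedBall (x := (0 : ℂ)) (r := 1 / η)).subset ?_
      intro h hh
      rw [mem_closedBall_zero_iff]
      exact hh.2.1.le
    have hdiff : DifferentiableOn ℂ F Γ := by
      apply DifferentiableOn.mul
      · have := hf.mono hΓU
        fun_prop
      · apply DifferentiableOn.fun_finsetProd
        intro i hi
        apply DifferentiableOn.div (by fun_prop) (by fun_prop)
        intro h hh
        exact sub_ne_zero.2 (hΓne h hh i hi)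
    have hfr : ∀ h ∈ frontier Ω, ‖F h‖ ≤ Real.exp (η * K / 2) := by
      intro h hh
      have hhΓ : h ∈ Γ := hcl (frontier_subset_closure hh)
      have hhΩ : h ∉ Ω := by
        rw [hΩo.frontier_eq] at hh; exact hh.2
      have hUh : h ∈ UHP := hΓU hhΓ
      have him : 0 < h.im := hUh
      apply (pow_le_pow_iff_left₀ (norm_nonneg _) (Real.exp_pos _).le two_ne_zero).1
      rw [← Real.exp_nat_mul, hFn]
      have e2 : ((2 : ℕ) : ℝ) * (η * K / 2) = η * K := by push_cast; ring
      rw [e2]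
      have hsmall : ∀ D : ℝ, 0 < D → (∀ i ∈ u, 4 * (W i).im * h.im / ‖h - W i‖ ^ 2 ≤ η * (16 / (W i).im)) →
          Real.exp (-4000 * (1 - ζ * f h).re) *
      ‖∏ i ∈ u, (h - (starRingEnd ℂ) (W i)) / (h - W i)‖ ^ 2 ≤ Real.exp (η * K) := by
        intro D hD hi
        have h1 := prod_sq_le u W hW h him (hΓne h hhΓ) (η * K) (by
          rw [hKdef, Finset.mul_sum]; exact Finset.sum_le_sum hi)
        have h2 : Real.exp (-4000 * (1 - ζ * f h).re) ≤ 1 := by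
          rw [Real.exp_le_one_iff]
          linarith [hre h 1 (hf1 h hUh)]
        calc _ ≤ 1 * Real.exp (η * K) := by gcongr
          _ = _ := one_mul _
      have hcases : h.im = η ∨ ‖h‖ = 1 / η ∨ ∃ i ∈ u, ‖h - W i‖ = (W i).im / 8 := by
        by_contra hcon
        push Not at hcon
        apply hhΩ
        simp only [hΩ, hΓ, mem_ofPred_eq] at *
        exact ⟨lt_of_le_of_ne hhΓ.1 (Ne.symm hcon.1), lt_of_le_of_ne hhΓ.2.1 hcon.2.1,
          fun i hi => lt_of_le_of_ne (hhΓ.2.2 i hi) (Ne.symm (hcon.2.2 i hi))⟩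
      rcases hcases with h1 | h1 | ⟨i, hi, h1⟩
      · apply hsmall 1 one_pos
        intro i hi
        have hy := hW i hi
        have : (W i).im / 2 ≤ ‖h - W i‖ := by
          have := (abs_le.1 (abs_im_le_norm (h - W i))).1
          simp only [sub_im] at this
          linarith [hηi i hi]
        have hp : 0 < ‖h - W i‖ := norm_pos_iff.2 (sub_ne_zero.2 (hΓne h hhΓ i hi))
        rw [h1, div_le_iff₀ (by positivity)]
        have : ((W i).im / 2) ^ 2 ≤ ‖h - W i‖ ^ 2 := by gcongr
        calc 4 * (W i).im * η = η * (16 / (W i).im) * ((W i).im / 2) ^ 2 := by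
              field_simp; norm_num
          _ ≤ _ := by gcongr
      · apply hsmall 1 one_pos
        intro i hi
        have hy := hW i hi
        have hy8 := hW8 i hi
        have hη4 : 4 ≤ 1 / η := by
          rw [le_div_iff₀ hη]; linarith
        have : (1 / η) / 2 ≤ ‖h - W i‖ := by
          have a1 := norm_sub_norm_le h (W i)
          have a2 := Complex.norm_le_abs_re_add_abs_im (W i)
          rw [abs_of_pos hy] at a2
          linarith [hWre i hi]
        have him2 : h.im ≤ 1 / η := by
          rw [← h1]; exact im_le_norm h
        have hp : 0 < ‖h - W i‖ := norm_pos_iff.2 (sub_ne_zero.2 (hΓne h hhΓ i hi))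
        rw [div_le_iff₀ (by positivity)]
        have : (1 / η / 2) ^ 2 ≤ ‖h - W i‖ ^ 2 := by gcongr
        calc 4 * (W i).im * h.im ≤ 4 * (W i).im * (1 / η) := by gcongr
          _ ≤ 4 / (W i).im * (1 / η) := by
              gcongr
              rw [le_div_iff₀ hy]; nlinarith
          _ = η * (16 / (W i).im) * (1 / η / 2) ^ 2 := by
              field_simp; norm_num
          _ ≤ _ := by gcongr
      · have h2 := prod_sq_le u W hW h him (hΓne h hhΓ) 2000
          (green_sum u W hW hdis h him (by
            simp only [hΓ, mem_ofPred_eq] at hhΓ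
            exact hhΓ.2.2))
        have h3 := hre h (1 / 2) (hdisc i hi h h1)
        calc _ ≤ Real.exp (-2000) * Real.exp 2000 := by
              gcongr; linarith
          _ = 1 := by rw [← Real.exp_add]; norm_num
          _ ≤ _ := Real.one_le_exp (by positivity)
    have hI : I ∈ Ω := by
      simp only [hΩ, mem_ofPred_eq]
      refine ⟨by simp; linarith, ?_, ?_⟩
      · rw [norm_I, lt_div_iff₀ hη]; linarith
      · intro i hi
        have := im_le_norm (I - W i)
        simp only [sub_im, I_im] at this
        linarith [hW8 i hi]
    have := Complex.norm_le_of_forall_mem_frontier_norm_le hbd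
      ((hdiff.mono hcl).diffContOnCl) hfr (subset_closure hI)
    calc ‖F I‖ ^ 2 ≤ Real.exp (η * K / 2) ^ 2 := by gcongr
      _ = _ := by
        rw [← Real.exp_nat_mul]; congr 1; push_cast; ring
  have hlim : ‖F I‖ ^ 2 ≤ 1 := by
    have t1 : Tendsto (fun η : ℝ => Real.exp (η * K)) (𝓝[>] 0) (𝓝 1) := by
      have : Tendsto (fun η : ℝ => Real.exp (η * K)) (𝓝 0) (𝓝 (Real.exp (0 * K))) :=
        (by fun_prop : Continuous fun η : ℝ => Real.exp (η * K)).tendsto 0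
      rw [zero_mul, Real.exp_zero] at this
      exact this.mono_left nhdsWithin_le_nhds
    refine ge_of_tendsto t1 ?_
    have e1 : ∀ᶠ η : ℝ in 𝓝[>] 0, η ≤ 1 / 4 :=
      nhdsWithin_le_nhds (eventually_le_nhds (by norm_num))
    have e2 : ∀ᶠ η : ℝ in 𝓝[>] 0, ∀ i ∈ u, η ≤ (W i).im / 2 := by
      rw [Filter.eventually_all_finset]
      intro i hi
      exact nhdsWithin_le_nhds (eventually_le_nhds (by linarith [hW i hi]))
    filter_upwards [e1, e2, self_mem_nhdsWithin] with η h1 h2 h3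
    exact main η h3 h1 h2
  have hneI : ∀ i ∈ u, I ≠ W i := by
    intro i hi he
    have := hW8 i hi
    rw [← he, I_im] at this
    linarith
  have hprod : 1 + 1 / 10 ≤ ‖∏ i ∈ u, (I - (starRingEnd ℂ) (W i)) / (I - W i)‖ ^ 2 := by
    rw [prod_sq_eq u W I hneI]
    refine le_trans ?_ (prod_sq_ge u _ ?_)
    · have : ∑ i ∈ u, 2 * (W i).im ≤ ∑ i ∈ u, 4 * (W i).im * I.im / ‖I - W i‖ ^ 2 := by
        apply Finset.sum_le_sum
        intro i hi
        have hy := hW i hi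
        have hy8 := hW8 i hi
        have hr := hWre i hi
        have h0 : 0 < ‖I - W i‖ := norm_pos_iff.2 (sub_ne_zero.2 (hneI i hi))
        rw [le_div_iff₀ (by positivity), ← normSq_eq_norm_sq, normSq_apply]
        simp only [sub_re, I_re, sub_im, I_im, zero_sub]
        have := sq_abs (W i).re
        have h4 : |(W i).re| ^ 2 ≤ (5 / 8) ^ 2 := by gcongr
        have h5 : -(W i).re * -(W i).re + (1 - (W i).im) * (1 - (W i).im) ≤ 2 := by nlinarith
        nlinarith
      rw [← Finset.mul_sum] at this
      linarith
    · intro i hi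
      have := hW i hi
      simp only [I_im]
      positivity
  rw [hFn, hζf] at hlim
  simp only [sub_re, one_re, ofReal_re] at hlim
  have h1 : Real.exp (-4000 * (1 - ‖f I‖)) * (1 + 1 / 10) ≤ 1 :=
    le_trans (mul_le_mul_of_nonneg_left hprod (Real.exp_pos _).le) hlim
  have h2 := Real.add_one_le_exp (-4000 * (1 - ‖f I‖))
  nlinarith

/-- nontangential smallness at every point of an interval -/
def NTSmall (f : ℂ → ℂ) (p q : ℝ) : Prop :=
  ∀ t : ℝ, p < t → t < q → ∀ ε : ℝ, 0 < ε →
    ∃ w : ℂ, 0 < w.im ∧ w.im < ε ∧ |t - w.re| ≤ w.im ∧ ‖f w‖ < ε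

lemma one_gen {f : ℂ → ℂ} (hf : DifferentiableOn ℂ f UHP) (hf1 : ∀ w ∈ UHP, ‖f w‖ ≤ 1)
    (hN : NTSmall f (-1) 1) : ‖f I‖ ≤ 1 - 1 / 44000 := by
  have hch : ∀ t : ℝ, ∃ w : ℂ, t ∈ Icc (-1 / 2 : ℝ) (1 / 2) →
      0 < w.im ∧ w.im < 1 / 8 ∧ |t - w.re| ≤ w.im ∧ ‖f w‖ ≤ 1 / 4 := by
    intro t
    by_cases ht : t ∈ Icc (-1 / 2 : ℝ) (1 / 2)
    · obtain ⟨w, h1, h2, h3, h4⟩ := hN t (by linarith [ht.1]) (by linarith [ht.2]) (1 / 8) (by norm_num)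
      exact ⟨w, fun _ => ⟨h1, h2, h3, by linarith⟩⟩
    · exact ⟨0, fun h => absurd h ht⟩
  choose W hW using hch
  obtain ⟨v, hv, hcov⟩ := (isCompact_Icc (a := (-1 / 2 : ℝ)) (b := 1 / 2)).elim_nhds_subcover
    (fun t => Metric.ball (W t).re (2 * (W t).im)) (by
      intro t ht
      apply Metric.isOpen_ball.mem_nhds
      rw [Metric.mem_ball, Real.dist_eq]
      linarith [(hW t ht).1, (hW t ht).2.2.1])
  obtain ⟨u, huv, hdis, hcov2⟩ := Vitali.exists_disjoint_subfamily_covering_enlargement_closedBall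
    (v : Set ℝ) (fun t => (W t).re) (fun t => 2 * (W t).im) 1 (by
      intro t ht
      linarith [(hW t (hv t ht)).2.1]) 5 (by norm_num)
  have hufin : u.Finite := v.finite_toSet.subset huv
  obtain ⟨u', rfl⟩ := hufin.exists_finset_coe
  have hu : ∀ i ∈ u', i ∈ Icc (-1 / 2 : ℝ) (1 / 2) := fun i hi => hv i (huv hi)
  apply one_gen_core u' W (fun i hi => (hW i (hu i hi)).1) (fun i hi => (hW i (hu i hi)).2.1)
    ?_ ?_ ?_ hf hf1 (fun i hi => (hW i (hu i hi)).2.2.2)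
  · intro i hi
    have h1 := hW i (hu i hi)
    have h2 := hu i hi
    have h3 := abs_le.1 h1.2.2.1
    rw [abs_le]
    constructor <;> linarith [h2.1, h2.2]
  · intro i hi j hj hij
    refine (hdis hi hj hij).mono ?_ ?_
    · exact Metric.closedBall_subset_closedBall (by linarith [(hW i (hu i hi)).1])
    · exact Metric.closedBall_subset_closedBall (by linarith [(hW j (hu j hj)).1])
  · have hsub : Icc (-1 / 2 : ℝ) (1 / 2) ⊆ ⋃ i ∈ u', Metric.closedBall (W i).re (10 * (W i).im) := by
      intro t ht
      have := hcov ht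
      simp only [mem_iUnion] at this ⊢
      obtain ⟨i, hi, hti⟩ := this
      obtain ⟨j, hj, hij⟩ := hcov2 i hi
      refine ⟨j, hj, ?_⟩
      have := hij (Metric.ball_subset_closedBall hti)
      have e : 10 * (W j).im = 5 * (2 * (W j).im) := by ring
      rw [e]; exact this
    have h1 := measure_mono (μ := volume) hsub
    have h2 := h1.trans (measure_biUnion_finset_le u' _)
    rw [Real.volume_Icc] at h2
    simp only [Real.volume_closedBall] at h2
    rw [← ENNReal.ofReal_sum_of_nonneg (by
      intro i hi
      linarith [(hW i (hu i hi)).1]), ENNReal.ofReal_le_ofReal_iff (Finset.sum_nonneg (by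
      intro i hi
      linarith [(hW i (hu i hi)).1]))] at h2
    have e : ∑ i ∈ u', 2 * (10 * (W i).im) = 20 * ∑ i ∈ u', (W i).im := by
      rw [Finset.mul_sum]
      exact Finset.sum_congr rfl fun i _ => by ring
    rw [e] at h2
    linarith

/-- affine scaling -/
lemma NTSmall.scale {f : ℂ → ℂ} {p q : ℝ} (h : NTSmall f p q) (b r : ℝ) (hr : 0 < r)
    {p' q' : ℝ} (hp : p ≤ b + r * p') (hq : b + r * q' ≤ q) :
    NTSmall (fun w => f (b + r * w)) p' q' := by
  intro t h1 h2 ε hε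
  obtain ⟨w, w1, w2, w3, w4⟩ := h (b + r * t) (by nlinarith) (by nlinarith) (min ε (r * ε))
    (by positivity)
  refine ⟨(w - b) / r, ?_, ?_, ?_, ?_⟩
  · rw [div_ofReal_im]; simp; positivity
  · rw [div_ofReal_im]; simp
    rw [div_lt_iff₀ hr]; linarith [min_le_right ε (r * ε)]
  · rw [div_ofReal_im, div_ofReal_re]
    simp only [sub_re, sub_im, ofReal_re, ofReal_im, sub_zero]
    rw [le_div_iff₀ hr, ← abs_of_pos hr, ← abs_mul, abs_of_pos hr]
    have : (t - (w.re - b) / r) * r = b + r * t - w.re := by field_simp; ring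
    rw [this]; exact w3
  · have hr' : (r : ℂ) ≠ 0 := by exact_mod_cast hr.ne'
    have : (b : ℂ) + r * ((w - b) / r) = w := by field_simp; ring
    simp only [this]
    exact w4.trans_le (min_le_left _ _)

lemma diff_scale {f : ℂ → ℂ} (hf : DifferentiableOn ℂ f UHP) (b r : ℝ) (hr : 0 < r) :
    DifferentiableOn ℂ (fun w : ℂ => f (b + r * w)) UHP := by
  apply hf.comp (by fun_prop)
  intro w hw
  simp only [UHP, mem_ofPred_eq, add_im, ofReal_im, mul_im, ofReal_re] at *
  simp; positivity

lemma UHP_scale {w : ℂ} (hw : w ∈ UHP) (b r : ℝ) (hr : 0 < r) : (b : ℂ) + r * w ∈ UHP := by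
  simp only [UHP, mem_ofPred_eq, add_im, ofReal_im, mul_im, ofReal_re] at *
  simp; positivity

lemma near_bound {f : ℂ → ℂ} (hf : DifferentiableOn ℂ f UHP) (hf1 : ∀ w ∈ UHP, ‖f w‖ ≤ 1)
    (hN : NTSmall f (-2) 2) (t η : ℝ) (ht : |t| ≤ 1) (hη : 0 < η) (hη1 : η ≤ 1) :
    ‖f (t + η * I)‖ ≤ 1 - 1 / 44000 := by
  have h3 := abs_le.1 ht
  exact one_gen (diff_scale hf t η hη) (fun w hw => hf1 _ (UHP_scale hw t η hη))
    (hN.scale t η hη (by linarith [h3.1]) (by linarith [h3.2]))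

def Vf (w : ℂ) : ℂ := -1 / (w + I) ^ 2

lemma UHP_add_I {w : ℂ} (hw : 0 ≤ w.im) : 1 ≤ ‖w + I‖ := by
  have := im_le_norm (w + I)
  simp at this
  linarith

lemma Vf_norm {w : ℂ} (hw : 0 ≤ w.im) : ‖Vf w‖ ≤ 1 := by
  have := UHP_add_I hw
  rw [Vf, norm_div, norm_neg, norm_one, norm_pow]
  apply div_le_one_of_le₀ _ (by positivity)
  nlinarith

lemma Vf_diff : DifferentiableOn ℂ Vf UHP := by
  unfold Vf
  apply DifferentiableOn.div (by fun_prop) (by fun_prop)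
  intro w hw
  have := UHP_add_I (le_of_lt hw)
  intro h
  rw [pow_eq_zero_iff two_ne_zero] at h
  rw [h, norm_zero] at this
  linarith

lemma Vf_re (t η : ℝ) (hη : 0 < η) (ht : 1 ≤ |t|) : (Vf (t + η * I)).re ≤ 3 * η := by
  have e : Vf (t + η * I) = -((t : ℂ) - (η + 1) * I) ^ 2 / ((t ^ 2 + (η + 1) ^ 2 : ℝ) : ℂ) ^ 2 := by
    unfold Vf
    have h1 : (t + η * I + I : ℂ) ≠ 0 := by
      intro h
      have := congrArg Complex.im h
      simp at this
      linarith
    have h2 : (((t ^ 2 + (η + 1) ^ 2 : ℝ)) : ℂ) ≠ 0 := by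
      have : (0:ℝ) < t ^ 2 + (η + 1) ^ 2 := by positivity
      exact_mod_cast this.ne'
    rw [div_eq_div_iff (pow_ne_zero _ h1) (pow_ne_zero _ h2)]
    have h3 : (((t ^ 2 + (η + 1) ^ 2 : ℝ)) : ℂ) = ((t : ℂ) - (η + 1) * I) * (t + η * I + I) := by
      push_cast
      linear_combination (((η : ℂ) + 1) ^ 2) * I_sq
    rw [h3]; ring
  have h0 : (0:ℝ) < t ^ 2 + (η + 1) ^ 2 := by positivity
  rw [e, ← ofReal_pow, div_ofReal_re]
  have : (-((t : ℂ) - (η + 1) * I) ^ 2).re = (η + 1) ^ 2 - t ^ 2 := by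
    simp [pow_two]
    ring
  rw [this, div_le_iff₀ (by positivity)]
  have ht2 : 1 ≤ t ^ 2 := by rw [← sq_abs]; nlinarith
  have h5 : 2 + 2 * η ≤ t ^ 2 + (η + 1) ^ 2 := by nlinarith
  have h6 : (2 + 2 * η) ^ 2 ≤ (t ^ 2 + (η + 1) ^ 2) ^ 2 := by gcongr
  have h7 : 3 * η * (2 + 2 * η) ^ 2 ≤ 3 * η * (t ^ 2 + (η + 1) ^ 2) ^ 2 := by gcongr
  have h8 : 0 < η ^ 3 := by positivity
  nlinarith

lemma Vf_re_pos (y : ℝ) (hy : 0 < y) : 0 < (Vf (y * I)).re := by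
  have : Vf (y * I) = ((1 / (y + 1) ^ 2 : ℝ) : ℂ) := by
    unfold Vf
    have h2 : ((y : ℂ) + 1) ≠ 0 := by
      have : (0:ℝ) < y + 1 := by positivity
      exact_mod_cast this.ne'
    have e : ((y : ℂ) * I + I) ^ 2 = -((y : ℂ) + 1) ^ 2 := by
      linear_combination (((y : ℂ) + 1) ^ 2) * I_sq
    rw [e]
    push_cast
    field_simp
  rw [this, ofReal_re]
  positivity

lemma iter_step {g : ℂ → ℂ} (hg : DifferentiableOn ℂ g UHP) (hg1 : ∀ w ∈ UHP, ‖g w‖ ≤ 1)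
    (hN : NTSmall g (-2) 2) (c : ℝ) (hc : c = 1 / 44000) :
    (∀ w ∈ UHP, ‖g w * Complex.exp (c * Vf w)‖ ≤ 1) ∧
    NTSmall (fun w => g w * Complex.exp (c * Vf w)) (-2) 2 := by
  have hc0 : 0 < c := by rw [hc]; norm_num
  have hcV : ∀ w : ℂ, ‖Complex.exp (c * Vf w)‖ = Real.exp (c * (Vf w).re) := by
    intro w; rw [Complex.norm_exp]; simp
  have hexp : ∀ w : ℂ, 0 ≤ w.im → ‖Complex.exp (c * Vf w)‖ ≤ Real.exp c := by
    intro w hw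
    rw [hcV, Real.exp_le_exp]
    have := (re_le_norm (Vf w)).trans (Vf_norm hw)
    nlinarith
  constructor
  · have key : ∀ η : ℝ, 0 < η → η ≤ 1 → ∀ w : ℂ, η ≤ w.im →
        ‖g w * Complex.exp (c * Vf w)‖ ≤ Real.exp (3 * c * η) := by
      intro η hη hη1 w hw
      refine halfplane_max (g := fun w => g w * Complex.exp (c * Vf w)) ?_ (Real.exp c) ?_ η hη _ ?_ w hw
      · have := Vf_diff
        fun_prop
      · intro w hw
        rw [norm_mul]
        calc _ ≤ 1 * Real.exp c := by
              gcongr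
              · exact hg1 w hw
              · exact hexp w (le_of_lt hw)
          _ = _ := one_mul _
      · intro t
        have hU : (t + η * I : ℂ) ∈ UHP := by simp [UHP, hη]
        rw [norm_mul]
        rcases le_total |t| 1 with ht | ht
        · have h1 := near_bound hg hg1 hN t η ht hη hη1
          have h2 := hexp _ (le_of_lt hU)
          have h3 : 1 - 1 / 44000 ≤ Real.exp (-c) := by
            have := Real.add_one_le_exp (-c)
            rw [hc] at *
            linarith
          calc _ ≤ Real.exp (-c) * Real.exp c := by
                gcongr
                linarith
            _ = 1 := by rw [← Real.exp_add]; simp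
            _ ≤ _ := Real.one_le_exp (by positivity)
        · rw [hcV]
          calc _ ≤ 1 * Real.exp (3 * c * η) := by
                refine mul_le_mul (hg1 _ hU) (Real.exp_le_exp.2 ?_) (Real.exp_pos _).le zero_le_one
                have := Vf_re t η hη ht
                nlinarith
            _ = _ := one_mul _
    intro w hw
    have t1 : Tendsto (fun η : ℝ => Real.exp (3 * c * η)) (𝓝[>] 0) (𝓝 1) := by
      have : Tendsto (fun η : ℝ => Real.exp (3 * c * η)) (𝓝 0) (𝓝 (Real.exp (3 * c * 0))) :=
        (by fun_prop : Continuous fun η : ℝ => Real.exp (3 * c * η)).tendsto 0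
      rw [mul_zero, Real.exp_zero] at this
      exact this.mono_left nhdsWithin_le_nhds
    refine ge_of_tendsto t1 ?_
    have e1 : ∀ᶠ η : ℝ in 𝓝[>] 0, η ≤ 1 :=
      nhdsWithin_le_nhds (eventually_le_nhds (by norm_num))
    have e2 : ∀ᶠ η : ℝ in 𝓝[>] 0, η ≤ w.im :=
      nhdsWithin_le_nhds (eventually_le_nhds hw)
    filter_upwards [e1, e2, self_mem_nhdsWithin] with η h1 h2 h3
    exact key η h3 h1 w h2
  · intro t h1 h2 ε hε
    obtain ⟨w, w1, w2, w3, w4⟩ := hN t h1 h2 (ε * Real.exp (-c)) (by positivity)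
    have h3 : Real.exp (-c) ≤ 1 := by rw [Real.exp_le_one_iff]; linarith
    refine ⟨w, w1, by nlinarith, w3, ?_⟩
    rw [norm_mul]
    calc _ ≤ ‖g w‖ * Real.exp c := by gcongr; exact hexp w w1.le
      _ < ε * Real.exp (-c) * Real.exp c := by gcongr
      _ = ε := by rw [mul_assoc, ← Real.exp_add]; simp

lemma UHP_convex : Convex ℝ UHP := by
  have : UHP = {z : ℂ | 0 < Complex.imCLM z} := by ext; simp [UHP]
  rw [this]
  exact convex_halfSpace_gt (f := fun z : ℂ => Complex.imCLM z) (Complex.imCLM.toLinearMap.isLinear) 0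

lemma privalov_norm {f : ℂ → ℂ} (hf : DifferentiableOn ℂ f UHP) (hf1 : ∀ w ∈ UHP, ‖f w‖ ≤ 1)
    (hN : NTSmall f (-2) 2) : ∀ w ∈ UHP, f w = 0 := by
  set c : ℝ := 1 / 44000 with hc
  have hit : ∀ k : ℕ, DifferentiableOn ℂ (fun w => f w * Complex.exp (c * Vf w) ^ k) UHP ∧
      (∀ w ∈ UHP, ‖f w * Complex.exp (c * Vf w) ^ k‖ ≤ 1) ∧
      NTSmall (fun w => f w * Complex.exp (c * Vf w) ^ k) (-2) 2 := by
    intro k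
    induction k with
    | zero => simpa using ⟨hf, hf1, hN⟩
    | succ k ih =>
      obtain ⟨a, b⟩ := iter_step ih.1 ih.2.1 ih.2.2 c hc
      have e : (fun w => f w * Complex.exp (c * Vf w) ^ (k + 1)) =
          fun w => f w * Complex.exp (c * Vf w) ^ k * Complex.exp (c * Vf w) := by
        funext w; ring
      rw [e]
      refine ⟨?_, ?_, b⟩
      · have := Vf_diff
        have h2 := ih.1
        fun_prop
      · intro w hw
        have := a w hw
        rw [pow_succ, ← mul_assoc]; exact this
  have hzero : ∀ y : ℝ, 0 < y → f (y * I) = 0 := by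
    intro y hy
    by_contra hne
    have hU : (y * I : ℂ) ∈ UHP := by simp [UHP, hy]
    have hV := Vf_re_pos y hy
    have h1 : 1 < Real.exp (c * (Vf (y * I)).re) := by
      rw [Real.one_lt_exp_iff]
      rw [hc]; positivity
    have ht := (tendsto_pow_atTop_atTop_of_one_lt h1).const_mul_atTop (norm_pos_iff.2 hne)
    obtain ⟨k, hk⟩ := (ht.eventually_gt_atTop 1).exists
    have := (hit k).2.1 _ hU
    rw [norm_mul, norm_pow, Complex.norm_exp] at this
    simp at this hk
    linarith
  have han : AnalyticOnNhd ℂ f UHP := hf.analyticOnNhd UHP_open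
  have hI : I ∈ UHP := by simp [UHP]
  have := han.eqOn_zero_of_preconnected_of_frequently_eq_zero UHP_convex.isPreconnected hI ?_
  · intro w hw; exact this hw
  · have ht : Tendsto (fun n : ℕ => (((1 + 1 / ((n : ℝ) + 1) : ℝ) : ℂ) * I)) atTop (𝓝[≠] I) := by
      rw [tendsto_nhdsWithin_iff]
      constructor
      · have h1 : Tendsto (fun n : ℕ => (1 + 1 / ((n : ℝ) + 1))) atTop (𝓝 (1 + 0)) :=
          tendsto_const_nhds.add tendsto_one_div_add_atTop_nhds_zero_nat
        have h2 := ((continuous_ofReal.tendsto _).comp h1).mul_const I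
        simpa using h2
      · refine Eventually.of_forall fun n h => ?_
        have := congrArg Complex.im h
        simp at this
        have h3 : (n : ℝ) + 1 ≠ 0 := by positivity
        rcases this with h | h <;> exact h3 (by exact_mod_cast h)
    refine ht.frequently (Eventually.of_forall fun n => ?_).frequently
    exact hzero _ (by positivity)

lemma privalov {f : ℂ → ℂ} (hf : DifferentiableOn ℂ f UHP) (B : ℝ) (hB : ∀ w ∈ UHP, ‖f w‖ ≤ B)
    (p q : ℝ) (hpq : p < q) (hN : NTSmall f p q) : ∀ w ∈ UHP, f w = 0 := by
  set B' := |B| + 1 with hB'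
  have hB0 : 0 < B' := by positivity
  set b := (p + q) / 2
  set r := (q - p) / 4
  have hr : 0 < r := by simp only [r]; linarith
  have hN2 := hN.scale b r hr (p' := -2) (q' := 2) (by simp only [b, r]; linarith)
    (by simp only [b, r]; linarith)
  have hBc : (B' : ℂ) ≠ 0 := by exact_mod_cast hB0.ne'
  have := privalov_norm (f := fun w => f (b + r * w) / B') ((diff_scale hf b r hr).div_const _) ?_ ?_
  · intro w hw
    have hw' : (w - b) / r ∈ UHP := by
      simp only [UHP, mem_ofPred_eq, div_ofReal_im] at *
      simp; positivity
    have h1 := this _ hw'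
    have hr' : (r : ℂ) ≠ 0 := by exact_mod_cast hr.ne'
    have : (b : ℂ) + r * ((w - b) / r) = w := by field_simp; ring
    simp only [this] at h1
    simpa [hBc] using h1
  · intro w hw
    rw [norm_div, norm_real, Real.norm_of_nonneg hB0.le]
    apply div_le_one_of_le₀ _ hB0.le
    exact (hB _ (UHP_scale hw b r hr)).trans (by rw [hB']; linarith [le_abs_self B])
  · intro t h1 h2 ε hε
    obtain ⟨w, w1, w2, w3, w4⟩ := hN2 t h1 h2 ε hε
    refine ⟨w, w1, w2, w3, ?_⟩
    rw [norm_div, norm_real, Real.norm_of_nonneg hB0.le]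
    refine lt_of_le_of_lt (div_le_self (norm_nonneg _) ?_) w4
    rw [hB']; linarith [abs_nonneg B]

/-- the slit plane `ℂ ∖ [0,∞)` -/
def SS : Set ℂ := {z : ℂ | z.re < 0 ∨ z.im ≠ 0}

lemma SS_open : IsOpen SS :=
  (isOpen_lt continuous_re continuous_const).union (isOpen_ne_fun continuous_im continuous_const)

lemma UHP_sub_SS : UHP ⊆ SS := fun z hz => Or.inr (ne_of_gt hz)

lemma SS_preconnected : IsPreconnected SS := by
  have : SS = (fun z : ℂ => -z) '' slitPlane := by
    ext z
    constructor
    · intro h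
      refine ⟨-z, ?_, neg_neg z⟩
      rw [mem_slitPlane_iff]
      rcases h with h | h
      · left; simpa using h
      · right; simpa using h
    · rintro ⟨w, hw, rfl⟩
      rw [mem_slitPlane_iff] at hw
      rcases hw with h | h
      · left; simpa using h
      · right; simpa using h
  rw [this]
  apply IsPreconnected.image _ _ (by fun_prop)
  have : (1 : ℂ) ∈ slitPlane := by simp [mem_slitPlane_iff]
  exact (Complex.starConvex_one_slitPlane.isPathConnected this).isConnected.isPreconnected

lemma SS_conj {z : ℂ} (hz : z ∈ SS) : (starRingEnd ℂ) z ∈ SS := by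
  rcases hz with h | h
  · left; simpa using h
  · right; simpa using h

instance nebotU (x : ℝ) : (𝓝[UHP] (x : ℂ)).NeBot := by
  rw [← mem_closure_iff_nhdsWithin_neBot, mem_closure_iff_seq_limit]
  refine ⟨fun n : ℕ => x + (1 / ((n : ℝ) + 1) : ℝ) * I, fun n => ?_, ?_⟩
  · have : 0 < 1 / ((n : ℝ) + 1) := by positivity
    simp only [UHP, mem_ofPred_eq, add_im, ofReal_im, im_ofReal_mul, I_im]
    linarith
  · have := (((continuous_ofReal.tendsto _).comp
      (tendsto_one_div_add_atTop_nhds_zero_nat (𝕜 := ℝ))).mul_const I).const_add (x : ℂ)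
    simpa using this

lemma freq_ivt (x : ℝ) {F : ℂ → ℝ} (hF : ContinuousOn F UHP) (r : ℝ)
    (h1 : ∃ᶠ z in 𝓝[UHP] (x : ℂ), F z ≤ r) (h2 : ∃ᶠ z in 𝓝[UHP] (x : ℂ), r ≤ F z) :
    ∃ᶠ z in 𝓝[UHP] (x : ℂ), F z = r := by
  have hb := nhdsWithin_hasBasis (Metric.nhds_basis_ball (x := (x : ℂ))) UHP
  rw [hb.frequently_iff] at *
  intro δ hδ
  obtain ⟨z1, hz1, e1⟩ := h1 δ hδ
  obtain ⟨z2, hz2, e2⟩ := h2 δ hδ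
  have hc : IsPreconnected (Metric.ball (x : ℂ) δ ∩ UHP) :=
    ((convex_ball _ _).inter UHP_convex).isPreconnected
  obtain ⟨z, hz, e⟩ := hc.intermediate_value hz1 hz2 (hF.mono inter_subset_right) ⟨e1, e2⟩
  exact ⟨z, hz, e⟩

lemma exists_cluster {l : Filter ℂ} [l.NeBot] {g : ℂ → ℂ}
    (hno : ¬ ∃ L : OnePoint ℂ, Tendsto (fun z => (g z : OnePoint ℂ)) l (𝓝 L)) :
    ∃ a : ℂ, MapClusterPt a l g := by
  by_contra hcon
  push Not at hcon
  apply hno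
  refine ⟨OnePoint.infty, ?_⟩
  apply OnePoint.tendsto_coe_infty.comp
  rw [coclosedCompact_eq_cocompact, ← Metric.cobounded_eq_cocompact,
    ← tendsto_norm_atTop_iff_cobounded, tendsto_atTop]
  intro R
  by_contra h
  rw [not_eventually] at h
  obtain ⟨a, _, ha⟩ := (isCompact_closedBall (0 : ℂ) R).exists_mapClusterPt_of_frequently
    (l := l) (f := g) (h.mono fun z hz => by
      rw [mem_closedBall_zero_iff]; exact (not_le.1 hz).le)
  exact hcon a ha

lemma cluster_sphere (x : ℝ) {g : ℂ → ℂ} (hg : ContinuousOn g UHP)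
    (hno : ¬ ∃ L : OnePoint ℂ, Tendsto (fun z => (g z : OnePoint ℂ)) (𝓝[UHP] (x : ℂ)) (𝓝 L))
    (a : ℂ) (ha : MapClusterPt a (𝓝[UHP] (x : ℂ)) g) :
    ∃ D : ℝ, 0 < D ∧ ∀ r : ℝ, 0 < r → r ≤ D → ∃ a' : ℂ, ‖a' - a‖ = r ∧
      MapClusterPt a' (𝓝[UHP] (x : ℂ)) g := by
  have hnt : ¬ Tendsto g (𝓝[UHP] (x : ℂ)) (𝓝 a) := by
    intro h
    exact hno ⟨a, (OnePoint.continuous_coe.tendsto a).comp h⟩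
  rw [Metric.tendsto_nhds] at hnt
  push Not at hnt
  obtain ⟨D, hD, hf⟩ := hnt
  refine ⟨D, hD, fun r hr hrD => ?_⟩
  have h1 : ∃ᶠ z in 𝓝[UHP] (x : ℂ), ‖g z - a‖ ≤ r := by
    rw [mapClusterPt_iff_frequently] at ha
    refine (ha _ (Metric.ball_mem_nhds a hr)).mono fun z hz => ?_
    rw [Metric.mem_ball, dist_eq_norm] at hz; exact hz.le
  have h2 : ∃ᶠ z in 𝓝[UHP] (x : ℂ), r ≤ ‖g z - a‖ := by
    refine hf.mono fun z hz => ?_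
    rw [dist_eq_norm] at hz
    linarith
  have h3 := freq_ivt x (F := fun z => ‖g z - a‖) (by fun_prop) r h1 h2
  obtain ⟨a', ha', hc⟩ := (isCompact_sphere a r).exists_mapClusterPt_of_frequently
    (l := 𝓝[UHP] (x : ℂ)) (f := g) (h3.mono fun z hz => by
      rw [mem_sphere_iff_norm]; exact hz)
  exact ⟨a', by rwa [mem_sphere_iff_norm] at ha', hc⟩

lemma cluster_filter {l : Filter ℂ} {g : ℂ → ℂ} {a : ℂ} (h : MapClusterPt a l g) :
    ∃ F : Filter ℂ, F.NeBot ∧ F ≤ l ∧ Tendsto g F (𝓝 a) := by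
  refine ⟨l ⊓ comap g (𝓝 a), ?_, inf_le_left, tendsto_inf_right tendsto_comap⟩
  rw [MapClusterPt, ClusterPt] at h
  rw [← map_neBot_iff g, Filter.push_pull, inf_comm]
  exact h

lemma id_SS {P : ℂ → ℂ} (hP : DifferentiableOn ℂ P SS) {a : ℂ} (ha : a ∈ SS)
    (hf : ∃ᶠ z in 𝓝[≠] a, P z = 0) : ∀ w ∈ SS, P w = 0 := by
  have := (hP.analyticOnNhd SS_open).eqOn_zero_of_preconnected_of_frequently_eq_zero
    SS_preconnected ha hf
  intro w hw; exact this hw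

lemma id_SS_of_UHP {P : ℂ → ℂ} (hP : DifferentiableOn ℂ P SS) (h : ∀ w ∈ UHP, P w = 0) :
    ∀ w ∈ SS, P w = 0 := by
  have hI : I ∈ UHP := by simp [UHP]
  refine id_SS hP (UHP_sub_SS hI) ?_
  have : ∀ᶠ z in 𝓝[≠] I, P z = 0 :=
    nhdsWithin_le_nhds (Filter.mem_of_superset (UHP_open.mem_nhds hI) h)
  exact this.frequently

lemma lemE (x : ℝ) {g : ℂ → ℂ} (hg : ContinuousOn g UHP) (hgS : ∀ z ∈ UHP, g z ∈ SS)
    {P : ℂ → ℂ} (hP : DifferentiableOn ℂ P SS)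
    (hPc : ∀ w ∈ SS, ‖P ((starRingEnd ℂ) w)‖ = ‖P w‖)
    {W : ℂ → ℝ} (hW : ContinuousOn W SS) (hWc : ∀ w ∈ SS, W ((starRingEnd ℂ) w) = W w)
    (hW0 : ∀ w ∈ SS, 0 ≤ W w)
    {N : ℂ → ℂ} (hN : DifferentiableOn ℂ N UHP) (hN0 : ∀ w ∈ UHP, N w ≠ 0)
    (B : ℝ) (hPN : ∀ w ∈ UHP, ‖P w‖ * ‖N w‖ ≤ B) (hWN : ∀ w ∈ UHP, W w * ‖N w‖ ≤ B)
    {e : ℂ → ℝ} (he : Tendsto e (𝓝[UHP] (x : ℂ)) (𝓝 0))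
    (hPe : ∀ᶠ z in 𝓝[UHP] (x : ℂ), ‖P (g z)‖ ≤ e z * W (g z)) :
    (∃ L : OnePoint ℂ, Tendsto (fun z => (g z : OnePoint ℂ)) (𝓝[UHP] (x : ℂ)) (𝓝 L)) ∨
      ∀ w ∈ SS, P w = 0 := by
  by_cases hno : ∃ L : OnePoint ℂ, Tendsto (fun z => (g z : OnePoint ℂ)) (𝓝[UHP] (x : ℂ)) (𝓝 L)
  · exact Or.inl hno
  right
  have hzero : ∀ a ∈ SS, MapClusterPt a (𝓝[UHP] (x : ℂ)) g → P a = 0 := by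
    intro a haS ha
    obtain ⟨F, hF, hFl, hga⟩ := cluster_filter ha
    have h1 : Tendsto (fun z => ‖P (g z)‖) F (𝓝 ‖P a‖) :=
      (((hP.continuousOn.continuousAt (SS_open.mem_nhds haS)).tendsto.comp hga)).norm
    have h2 : Tendsto (fun z => e z * W (g z)) F (𝓝 (0 * W a)) :=
      (he.mono_left hFl).mul ((hW.continuousAt (SS_open.mem_nhds haS)).tendsto.comp hga)
    have h3 := le_of_tendsto_of_tendsto h1 h2 (hFl hPe)
    rw [zero_mul] at h3
    exact norm_le_zero_iff.1 h3
  by_cases hA : ∃ a ∈ SS, MapClusterPt a (𝓝[UHP] (x : ℂ)) g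
  · obtain ⟨a, haS, ha⟩ := hA
    obtain ⟨D, hD, hDr⟩ := cluster_sphere x hg hno a ha
    refine id_SS hP haS ?_
    have hb := nhdsWithin_hasBasis (Metric.nhds_basis_ball (x := a)) ({a}ᶜ)
    rw [hb.frequently_iff]
    intro δ hδ
    obtain ⟨δ', hδ', hsub⟩ := Metric.isOpen_iff.1 SS_open a haS
    obtain ⟨a', h1, h2⟩ := hDr (min D (min δ δ' / 2)) (by positivity) (min_le_left _ _)
    have h3 : ‖a' - a‖ ≤ min δ δ' / 2 := h1.trans_le (min_le_right _ _)
    have h5 : 0 < min δ δ' := by positivity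
    refine ⟨a', ⟨?_, ?_⟩, hzero a' (hsub ?_) h2⟩
    · rw [Metric.mem_ball, dist_eq_norm]
      linarith [min_le_left δ δ']
    · intro h
      rw [mem_singleton_iff] at h
      rw [h, sub_self, norm_zero] at h1
      have : 0 < min D (min δ δ' / 2) := by positivity
      linarith
    · rw [Metric.mem_ball, dist_eq_norm]
      linarith [min_le_right δ δ']
  · push Not at hA
    have hpos : ∀ a, MapClusterPt a (𝓝[UHP] (x : ℂ)) g → a = (‖a‖ : ℂ) := by
      intro a ha
      by_contra h
      apply hA a _ ha
      by_contra h2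
      have h2' : ¬ (a.re < 0 ∨ a.im ≠ 0) := h2
      push Not at h2'
      apply h
      have h3 : a = (a.re : ℂ) := by apply Complex.ext <;> simp [h2'.2]
      rw [h3, norm_real, Real.norm_of_nonneg h2'.1]
    apply id_SS_of_UHP hP
    obtain ⟨a, ha⟩ := exists_cluster hno
    obtain ⟨D, hD, hDr⟩ := cluster_sphere x hg hno a ha
    obtain ⟨b, hab, hb⟩ := hDr D hD le_rfl
    obtain ⟨p, q, hpq, h0p, hp, hq⟩ : ∃ p q : ℝ, p < q ∧ 0 ≤ p ∧
        MapClusterPt (p : ℂ) (𝓝[UHP] (x : ℂ)) g ∧ MapClusterPt (q : ℂ) (𝓝[UHP] (x : ℂ)) g := by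
      have ha' := hpos a ha
      have hb' := hpos b hb
      have hne : ‖a‖ ≠ ‖b‖ := by
        intro h
        rw [ha', hb', h, sub_self, norm_zero] at hab
        linarith
      rw [ha'] at ha
      rw [hb'] at hb
      rcases lt_or_gt_of_ne hne with h | h
      · exact ⟨_, _, h, norm_nonneg _, ha, hb⟩
      · exact ⟨_, _, h, norm_nonneg _, hb, ha⟩
    have hPN0 := privalov (f := fun w => P w * N w)
      ((hP.mono UHP_sub_SS).mul hN) B (fun w hw => by rw [norm_mul]; exact hPN w hw) p q hpq ?_
    · intro w hw
      exact (mul_eq_zero.1 (hPN0 w hw)).resolve_right (hN0 w hw)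
    intro t htp htq ε hε
    have ht0 : 0 < t := by linarith
    rw [mapClusterPt_iff_frequently] at hp hq
    have f1 : ∃ᶠ z in 𝓝[UHP] (x : ℂ), ‖g z‖ ≤ t := by
      refine (hp _ (Metric.ball_mem_nhds _ (sub_pos.2 htp))).mono fun z hz => ?_
      rw [Metric.mem_ball, dist_eq_norm] at hz
      have := norm_le_norm_add_norm_sub' (g z) (p : ℂ)
      rw [norm_real, Real.norm_of_nonneg h0p] at this
      linarith
    have f2 : ∃ᶠ z in 𝓝[UHP] (x : ℂ), t ≤ ‖g z‖ := by
      refine (hq _ (Metric.ball_mem_nhds _ (sub_pos.2 htq))).mono fun z hz => ?_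
      rw [Metric.mem_ball, dist_eq_norm] at hz
      have := norm_le_norm_add_norm_sub (g z) (q : ℂ)
      rw [norm_real, Real.norm_of_nonneg (by linarith : 0 ≤ q)] at this
      linarith
    have f3 := freq_ivt x (F := fun z => ‖g z‖) (by fun_prop) t f1 f2
    have hne : (𝓝[UHP] (x : ℂ) ⊓ 𝓟 {z | ‖g z‖ = t}).NeBot := by
      rw [← frequently_mem_iff_neBot]; exact f3
    obtain ⟨b, hb1, hb2⟩ := (isCompact_sphere (0 : ℂ) t).exists_mapClusterPt_of_frequently
      (l := 𝓝[UHP] (x : ℂ) ⊓ 𝓟 {z | ‖g z‖ = t}) (f := g) (by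
        apply Eventually.frequently
        refine mem_inf_of_right ?_
        intro z hz
        rw [Set.mem_ofPred_eq, mem_sphere_iff_norm, sub_zero]; exact hz)
    have hbt : b = (t : ℂ) := by
      have h1 := hpos b (hb2.mono inf_le_left)
      rw [mem_sphere_iff_norm, sub_zero] at hb1
      rw [h1, hb1]
    rw [hbt, mapClusterPt_iff_frequently] at hb2
    have f4 := hb2 _ (Metric.ball_mem_nhds (t : ℂ) (lt_min ht0 hε))
    have f5 : ∀ᶠ z in 𝓝[UHP] (x : ℂ) ⊓ 𝓟 {z | ‖g z‖ = t},
        ‖g z‖ = t ∧ z ∈ UHP ∧ ‖P (g z)‖ ≤ e z * W (g z) ∧ |e z| * (|B| + 1) < ε := by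
      refine Filter.Eventually.and (mem_inf_of_right (mem_principal_self _)) (mem_inf_of_left ?_)
      refine Filter.Eventually.and self_mem_nhdsWithin (hPe.and ?_)
      have : Tendsto (fun z => |e z| * (|B| + 1)) (𝓝[UHP] (x : ℂ)) (𝓝 (|0| * (|B| + 1))) :=
        he.abs.mul_const _
      rw [abs_zero, zero_mul] at this
      exact this.eventually (gt_mem_nhds hε)
    obtain ⟨z, hz1, hz2, hz3, hz4, hz5⟩ := (f4.and_eventually f5).exists
    rw [Metric.mem_ball, dist_eq_norm] at hz1
    have hzt := hz1.trans_le (min_le_left _ _)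
    have hzε := hz1.trans_le (min_le_right _ _)
    have hgS' := hgS z hz3
    have hre : 0 < (g z).re := by
      have := (abs_lt.1 ((abs_re_le_norm _).trans_lt hzt)).1
      simp at this
      linarith
    have him : (g z).im ≠ 0 := by
      rcases hgS' with h | h
      · linarith
      · exact h
    obtain ⟨w, hw1, hw2, hw3, hw4, hw5⟩ : ∃ w : ℂ, 0 < w.im ∧ w.re = (g z).re ∧
        w.im ^ 2 = (g z).im ^ 2 ∧ ‖P w‖ = ‖P (g z)‖ ∧ W w = W (g z) := by
      rcases lt_or_gt_of_ne him with h | h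
      · exact ⟨(starRingEnd ℂ) (g z), by simpa using h, by simp, by simp, hPc _ hgS', hWc _ hgS'⟩
      · exact ⟨g z, h, rfl, rfl, rfl, rfl⟩
    have hsq : (g z).re ^ 2 + (g z).im ^ 2 = t ^ 2 := by
      rw [← hz2, ← normSq_eq_norm_sq, normSq_apply]; ring
    have hle : (g z).re ≤ t := by rw [← hz2]; exact re_le_norm _
    have hwim : w.im ≤ ‖g z - t‖ := by
      apply abs_le_of_sq_le_sq' _ (norm_nonneg _) |>.2
      rw [hw3, ← normSq_eq_norm_sq, normSq_apply]
      simp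
      nlinarith
    refine ⟨w, hw1, hwim.trans_lt hzε, ?_, ?_⟩
    · rw [hw2, abs_of_nonneg (by linarith)]
      apply abs_le_of_sq_le_sq' _ hw1.le |>.2
      rw [hw3]; nlinarith
    · simp only [norm_mul]
      have hWw : 0 ≤ W w := hW0 w (UHP_sub_SS hw1)
      calc ‖P w‖ * ‖N w‖ ≤ (|e z| * W w) * ‖N w‖ := by
            gcongr
            rw [hw4]
            refine hz4.trans ?_
            rw [hw5]
            rw [hw5] at hWw
            gcongr
            exact le_abs_self _
        _ = |e z| * (W w * ‖N w‖) := by ring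
        _ ≤ |e z| * (|B| + 1) := by
            gcongr
            linarith [hWN w hw1, le_abs_self B]
        _ < ε := hz5

def NN (σ : Measure ℝ) (z : ℂ) : ℂ := ∫ t : ℝ, (1 - z * (t : ℂ) ^ 2)⁻¹ ∂σ

lemma kern_lower0 {z : ℂ} (hz : z ∈ SS) : ∃ δ > (0 : ℝ), ∀ t : ℝ,
    2 * δ * (1 + t ^ 2) ≤ ‖1 - z * (t : ℂ) ^ 2‖ := by
  have hre : ∀ t : ℝ, (1 - z * (t : ℂ) ^ 2).re = 1 - z.re * t ^ 2 := by
    intro t; rw [← ofReal_pow, sub_re, re_mul_ofReal, one_re]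
  have him : ∀ t : ℝ, (1 - z * (t : ℂ) ^ 2).im = - (z.im * t ^ 2) := by
    intro t; rw [← ofReal_pow, sub_im, im_mul_ofReal, one_im, zero_sub]
  by_cases h : z.im = 0
  · have h2 : z.re < 0 := hz.resolve_right (by simpa using h)
    refine ⟨min 1 (-z.re) / 2, ?_, fun t => ?_⟩
    · have : 0 < -z.re := by linarith
      positivity
    · have h3 := re_le_norm (1 - z * (t : ℂ) ^ 2)
      rw [hre] at h3
      have h4 := min_le_left 1 (-z.re)
      have h5 := min_le_right 1 (-z.re)
      nlinarith [sq_nonneg t]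
  · have hy : 0 < |z.im| := abs_pos.2 h
    have hm : 0 < ‖z‖ := hy.trans_le (abs_im_le_norm z)
    set y := |z.im|
    set m := ‖z‖
    set β := y / (2 * (y + m)) with hβ
    have hβ0 : 0 < β := by positivity
    have hβe : β * (y + m) = y / 2 := by rw [hβ]; field_simp
    have hβ1 : β ≤ 1 := by
      rw [hβ, div_le_one (by positivity)]; linarith
    refine ⟨min β (y / 2) / 2, by positivity, fun t => ?_⟩
    have h1 : y * t ^ 2 ≤ ‖1 - z * (t : ℂ) ^ 2‖ := by
      have := abs_im_le_norm (1 - z * (t : ℂ) ^ 2)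
      rw [him, abs_neg, abs_mul, abs_of_nonneg (sq_nonneg t)] at this
      exact this
    have h2 : 1 - m * t ^ 2 ≤ ‖1 - z * (t : ℂ) ^ 2‖ := by
      have := norm_sub_norm_le 1 (z * (t : ℂ) ^ 2)
      rw [norm_mul, norm_pow, norm_real, norm_one, Real.norm_eq_abs, sq_abs] at this
      exact this
    have h4 := min_le_left β (y / 2)
    have h5 := min_le_right β (y / 2)
    have h6 : (1 - β) * (y * t ^ 2) + β * (1 - m * t ^ 2) ≤ ‖1 - z * (t : ℂ) ^ 2‖ := by
      nlinarith
    have h7 : (1 - β) * (y * t ^ 2) + β * (1 - m * t ^ 2) = β + (y / 2) * t ^ 2 := by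
      linear_combination (-t ^ 2) * hβe
    nlinarith [sq_nonneg t]

lemma kern_lower {z : ℂ} (hz : z ∈ SS) : ∃ δ > (0 : ℝ), ∀ w ∈ Metric.ball z δ, ∀ t : ℝ,
    δ * (1 + t ^ 2) ≤ ‖1 - w * (t : ℂ) ^ 2‖ := by
  obtain ⟨δ, hδ, h⟩ := kern_lower0 hz
  refine ⟨δ, hδ, fun w hw t => ?_⟩
  rw [Metric.mem_ball, dist_eq_norm] at hw
  have h1 := h t
  have h2 : ‖(w - z) * (t : ℂ) ^ 2‖ ≤ δ * t ^ 2 := by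
    rw [norm_mul, norm_pow, norm_real, Real.norm_eq_abs, sq_abs]
    gcongr
  have h3 : 1 - z * (t : ℂ) ^ 2 = (1 - w * (t : ℂ) ^ 2) + (w - z) * (t : ℂ) ^ 2 := by ring
  have h4 := norm_add_le (1 - w * (t : ℂ) ^ 2) ((w - z) * (t : ℂ) ^ 2)
  rw [← h3] at h4
  nlinarith [sq_nonneg t]

lemma kern_ne {z : ℂ} (hz : z ∈ SS) (t : ℝ) : 1 - z * (t : ℂ) ^ 2 ≠ 0 := by
  obtain ⟨δ, hδ, h⟩ := kern_lower0 hz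
  have := h t
  intro h0
  rw [h0, norm_zero] at this
  have : 0 < 2 * δ * (1 + t ^ 2) := by positivity
  linarith

lemma kern_meas (z : ℂ) : Measurable fun t : ℝ => (1 - z * (t : ℂ) ^ 2)⁻¹ := by
  fun_prop

lemma kern_bdd {z : ℂ} (hz : z ∈ SS) : ∃ K : ℝ, 0 < K ∧ ∀ t : ℝ,
    ‖(1 - z * (t : ℂ) ^ 2)⁻¹‖ ≤ K ∧ t ^ 2 * ‖(1 - z * (t : ℂ) ^ 2)⁻¹‖ ≤ K := by
  obtain ⟨δ, hδ, h⟩ := kern_lower0 hz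
  refine ⟨1 / (2 * δ), by positivity, fun t => ?_⟩
  have h1 := h t
  have h2 : 0 < ‖1 - z * (t : ℂ) ^ 2‖ := norm_pos_iff.2 (kern_ne hz t)
  rw [norm_inv]
  constructor
  · rw [inv_eq_one_div]
    rw [div_le_div_iff₀ h2 (by positivity)]
    nlinarith [sq_nonneg t]
  · rw [← div_eq_mul_inv, div_le_div_iff₀ h2 (by positivity)]
    nlinarith [sq_nonneg t]

lemma bdd_int {σ : Measure ℝ} [IsFiniteMeasure σ] {f : ℝ → ℂ} (hf : Measurable f) (K : ℝ) (h : ∀ t, ‖f t‖ ≤ K) : Integrable f σ :=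
  Integrable.of_bound hf.aestronglyMeasurable K (Eventually.of_forall h)

lemma kern_int {σ : Measure ℝ} [IsFiniteMeasure σ] {z : ℂ} (hz : z ∈ SS) : Integrable (fun t : ℝ => (1 - z * (t : ℂ) ^ 2)⁻¹) σ := by
  obtain ⟨K, _, h⟩ := kern_bdd hz
  exact bdd_int (kern_meas z) K fun t => (h t).1

lemma kern_int2 {σ : Measure ℝ} [IsFiniteMeasure σ] {z : ℂ} (hz : z ∈ SS) :
    Integrable (fun t : ℝ => (t : ℂ) ^ 2 * (1 - z * (t : ℂ) ^ 2)⁻¹) σ := by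
  obtain ⟨K, _, h⟩ := kern_bdd hz
  refine bdd_int (by fun_prop) K fun t => ?_
  rw [norm_mul, norm_pow, norm_real, Real.norm_eq_abs, sq_abs]
  exact (h t).2

lemma NN_diff (σ : Measure ℝ) [IsFiniteMeasure σ] : DifferentiableOn ℂ (NN σ) SS := by
  intro z hz
  apply DifferentiableAt.differentiableWithinAt
  obtain ⟨δ, hδ, h⟩ := kern_lower hz
  have hne : ∀ w ∈ Metric.ball z δ, ∀ t : ℝ, 1 - w * (t : ℂ) ^ 2 ≠ 0 := by
    intro w hw t h0
    have := h w hw t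
    rw [h0, norm_zero] at this
    have : 0 < δ * (1 + t ^ 2) := by positivity
    linarith
  have := hasDerivAt_integral_of_dominated_loc_of_deriv_le (μ := σ)
    (F := fun w t => (1 - w * ((t : ℝ) : ℂ) ^ 2)⁻¹) (F' := fun w t => (t : ℂ) ^ 2 / (1 - w * (t : ℂ) ^ 2) ^ 2)
    (x₀ := z) (bound := fun _ => 1 / δ ^ 2) (s := Metric.ball z δ) (Metric.ball_mem_nhds z hδ)
    (Eventually.of_forall fun w => (kern_meas w).aestronglyMeasurable) (kern_int hz)
    (by
      apply Measurable.aestronglyMeasurable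
      fun_prop) ?_ (integrable_const _) ?_
  · exact this.2.differentiableAt
  · refine Eventually.of_forall fun t w hw => ?_
    have h1 := h w hw t
    have h2 : (δ * (1 + t ^ 2)) ^ 2 ≤ ‖1 - w * (t : ℂ) ^ 2‖ ^ 2 := by gcongr
    have h3 : 0 < ‖1 - w * (t : ℂ) ^ 2‖ := norm_pos_iff.2 (hne w hw t)
    rw [norm_div, norm_pow, norm_pow, norm_real, Real.norm_eq_abs, sq_abs,
      div_le_div_iff₀ (by positivity) (by positivity)]
    nlinarith [sq_nonneg t, sq_nonneg (t ^ 2), sq_nonneg δ, mul_nonneg (sq_nonneg δ) (sq_nonneg t),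
      mul_nonneg (sq_nonneg δ) (sq_nonneg (t ^ 2))]
  · refine Eventually.of_forall fun t w hw => ?_
    have h1 : HasDerivAt (fun w : ℂ => 1 - w * (t : ℂ) ^ 2) (-(t : ℂ) ^ 2) w := by
      have := ((hasDerivAt_id w).mul_const ((t : ℂ) ^ 2)).const_sub 1
      simpa using this
    have := h1.inv (hne w hw t)
    rw [neg_neg] at this
    exact this

lemma NN_conj {σ : Measure ℝ} (z : ℂ) : NN σ ((starRingEnd ℂ) z) = (starRingEnd ℂ) (NN σ z) := by
  unfold NN
  rw [← integral_conj]
  congr 1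
  funext t
  simp

lemma Mt_eq (σ : Measure ℝ) [IsProbabilityMeasure σ] {z : ℂ} (hz : z ∈ SS) :
    Mt σ z = NN σ z - 1 := by
  have h1 : (1 : ℂ) = ∫ _ : ℝ, (1 : ℂ) ∂σ := by simp
  rw [h1, NN, ← integral_sub (kern_int hz) (integrable_const _), Mt]
  congr 1
  funext t
  have := kern_ne hz t
  field_simp
  ring

lemma rectC_eq (G : Measure ℝ) [IsFiniteMeasure G] {z : ℂ} (hz : z ∈ SS) :
    rectC G z = (z + 1) * NN G z - (G.real univ : ℂ) := by
  have h1 : (G.real univ : ℂ) = ∫ _ : ℝ, (1 : ℂ) ∂G := by simp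
  rw [h1, NN, ← integral_const_mul, ← integral_sub ((kern_int hz).const_mul _) (integrable_const _),
    rectC, ← integral_const_mul]
  congr 1
  funext t
  have := kern_ne hz t
  field_simp
  ring

lemma Mt_diff (σ : Measure ℝ) [IsProbabilityMeasure σ] : DifferentiableOn ℂ (Mt σ) SS :=
  ((NN_diff σ).sub_const 1).congr fun _ hz => Mt_eq σ hz

lemma rectC_diff (G : Measure ℝ) [IsFiniteMeasure G] : DifferentiableOn ℂ (rectC G) SS := by
  have : DifferentiableOn ℂ (fun z => (z + 1) * NN G z - (G.real univ : ℂ)) SS := by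
    have := NN_diff G
    fun_prop
  exact this.congr fun _ hz => rectC_eq G hz

lemma Mt_conj (σ : Measure ℝ) (z : ℂ) : Mt σ ((starRingEnd ℂ) z) = (starRingEnd ℂ) (Mt σ z) := by
  unfold Mt
  rw [← integral_conj]
  congr 1
  funext t
  simp

lemma rectC_conj (G : Measure ℝ) (z : ℂ) :
    rectC G ((starRingEnd ℂ) z) = (starRingEnd ℂ) (rectC G z) := by
  unfold rectC
  rw [map_mul, ← integral_conj]
  congr 2
  funext t
  simp

lemma Ht_conj (l : ℝ) (σ : Measure ℝ) (z : ℂ) :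
    Ht l σ ((starRingEnd ℂ) z) = (starRingEnd ℂ) (Ht l σ z) := by
  simp [Ht, Mt_conj]

lemma Ht_diff (l : ℝ) (σ : Measure ℝ) [IsProbabilityMeasure σ] : DifferentiableOn ℂ (Ht l σ) SS := by
  unfold Ht
  have := Mt_diff σ
  fun_prop

lemma Ht_eq (l : ℝ) (σ : Measure ℝ) (z : ℂ) : Ht l σ z = z * Tfun l (Mt σ z) := by
  unfold Ht Tfun; ring

lemma neg_mem_SS {x : ℝ} (hx : x < 0) : (x : ℂ) ∈ SS := Or.inl (by simpa using hx)

lemma NN_tendsto (σ : Measure ℝ) [IsFiniteMeasure σ] :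
    Tendsto (fun x : ℝ => NN σ (x : ℂ)) (𝓝[<] 0) (𝓝 (σ.real univ : ℂ)) := by
  have h1 : (σ.real univ : ℂ) = ∫ _ : ℝ, (1 : ℂ) ∂σ := by simp
  rw [h1]
  unfold NN
  apply tendsto_integral_filter_of_dominated_convergence (fun _ => (1 : ℝ))
  · exact Eventually.of_forall fun x => (kern_meas _).aestronglyMeasurable
  · filter_upwards [self_mem_nhdsWithin] with x hx
    refine Eventually.of_forall fun t => ?_
    have hx' : x < 0 := hx
    have e : (1 - (x : ℂ) * (t : ℂ) ^ 2) = ((1 - x * t ^ 2 : ℝ) : ℂ) := by push_cast; ring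
    have h2 : 1 ≤ 1 - x * t ^ 2 := by nlinarith [sq_nonneg t]
    rw [e, norm_inv, norm_real, Real.norm_of_nonneg (by linarith)]
    exact inv_le_one_of_one_le₀ h2
  · exact integrable_const _
  · refine Eventually.of_forall fun t => ?_
    have : ContinuousAt (fun x : ℝ => (1 - (x : ℂ) * (t : ℂ) ^ 2)⁻¹) 0 := by
      apply ContinuousAt.inv₀ (by fun_prop)
      simp
    have h2 := this.tendsto
    simp only [ofReal_zero, zero_mul, sub_zero, inv_one] at h2
    exact h2.mono_left nhdsWithin_le_nhds

lemma Mt_tendsto (σ : Measure ℝ) [IsProbabilityMeasure σ] :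
    Tendsto (fun x : ℝ => Mt σ (x : ℂ)) (𝓝[<] 0) (𝓝 0) := by
  have := (NN_tendsto σ).sub_const 1
  simp only [probReal_univ, ofReal_one, sub_self] at this
  refine this.congr' ?_
  filter_upwards [self_mem_nhdsWithin] with x hx
  exact (Mt_eq σ (neg_mem_SS hx)).symm

lemma rectC_tendsto (G : Measure ℝ) [IsFiniteMeasure G] :
    Tendsto (fun x : ℝ => rectC G (x : ℂ)) (𝓝[<] 0) (𝓝 0) := by
  have h0 : Tendsto (fun x : ℝ => (x : ℂ) + 1) (𝓝[<] 0) (𝓝 (((0 : ℝ) : ℂ) + 1)) :=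
    ((by fun_prop : Continuous fun x : ℝ => (x : ℂ) + 1).tendsto 0).mono_left nhdsWithin_le_nhds
  have := (h0.mul (NN_tendsto G)).sub_const (G.real univ : ℂ)
  simp only [ofReal_zero, zero_add, one_mul, sub_self] at this
  refine this.congr' ?_
  filter_upwards [self_mem_nhdsWithin] with x hx
  exact (rectC_eq G (neg_mem_SS hx)).symm

lemma int_im {σ : Measure ℝ} {f : ℝ → ℂ} (hf : Integrable f σ) :
    (∫ t, f t ∂σ).im = ∫ t, (f t).im ∂σ := (imCLM.integral_comp_comm hf).symm

lemma int_im_nonneg {σ : Measure ℝ} {f : ℝ → ℂ} (hf : Integrable f σ) (h : ∀ t, 0 ≤ (f t).im) :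
    0 ≤ (∫ t, f t ∂σ).im := by
  rw [int_im hf]; exact integral_nonneg h

lemma int_im_pos {σ : Measure ℝ} {f : ℝ → ℂ} (hf : Integrable f σ) (h : ∀ t, 0 ≤ (f t).im)
    (hs : σ {t | 0 < (f t).im} ≠ 0) :
    0 < (∫ t, f t ∂σ).im := by
  rw [int_im hf, integral_pos_iff_support_of_nonneg h (imCLM.integrable_comp hf)]
  refine lt_of_lt_of_le (pos_iff_ne_zero.2 hs) (measure_mono fun t ht => ?_)
  exact ne_of_gt ht

lemma kern_im {z : ℂ} (t : ℝ) :
    ((1 - z * (t : ℂ) ^ 2)⁻¹).im = z.im * t ^ 2 / normSq (1 - z * (t : ℂ) ^ 2) := by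
  rw [inv_im, ← ofReal_pow, sub_im, im_mul_ofReal, one_im, zero_sub, neg_neg]

lemma kern_zim {z : ℂ} (t : ℝ) :
    (z * (1 - z * (t : ℂ) ^ 2)⁻¹).im = z.im / normSq (1 - z * (t : ℂ) ^ 2) := by
  rw [mul_im, inv_im, inv_re, ← ofReal_pow, sub_im, im_mul_ofReal, one_im, sub_re,
    re_mul_ofReal, one_re]
  ring

lemma kern_nsq {z : ℂ} (hz : z ∈ SS) (t : ℝ) : 0 < normSq (1 - z * (t : ℂ) ^ 2) :=
  normSq_pos.2 (kern_ne hz t)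

lemma NN_im_nonneg {σ : Measure ℝ} [IsFiniteMeasure σ] {z : ℂ} (hz : z ∈ UHP) :
    0 ≤ (NN σ z).im := by
  have hS := UHP_sub_SS hz
  have hz' : 0 < z.im := hz
  refine int_im_nonneg (kern_int hS) fun t => ?_
  rw [kern_im]
  have := kern_nsq hS t
  positivity

lemma zNN_im_pos {σ : Measure ℝ} [IsFiniteMeasure σ] (h0 : σ ≠ 0) {z : ℂ} (hz : z ∈ UHP) :
    0 < (z * NN σ z).im := by
  have hS := UHP_sub_SS hz
  have hz' : 0 < z.im := hz
  rw [NN, ← integral_const_mul]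
  have hp : ∀ t : ℝ, 0 < (z * (1 - z * (t : ℂ) ^ 2)⁻¹).im := by
    intro t
    rw [kern_zim]
    have := kern_nsq hS t
    positivity
  refine int_im_pos ((kern_int hS).const_mul z) (fun t => (hp t).le) ?_
  have : {t : ℝ | 0 < (z * (1 - z * (t : ℂ) ^ 2)⁻¹).im} = univ := by
    ext t; simp only [mem_ofPred_eq, mem_univ, iff_true]; exact hp t
  rw [this]
  simpa using h0

lemma Mt_im_nonneg (σ : Measure ℝ) [IsProbabilityMeasure σ] {z : ℂ} (hz : z ∈ UHP) :
    0 ≤ (Mt σ z).im := by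
  rw [Mt_eq σ (UHP_sub_SS hz)]
  simpa using NN_im_nonneg (σ := σ) hz

lemma eq_dirac_of {σ : Measure ℝ} [IsProbabilityMeasure σ] (h : σ {t : ℝ | t ≠ 0} = 0) :
    σ = Measure.dirac 0 := by
  have h1 : (fun t : ℝ => t) =ᵐ[σ] fun _ => (0 : ℝ) := by
    rw [Filter.EventuallyEq, ae_iff]; exact h
  have h2 : σ.map (fun t : ℝ => t) = σ.map (fun _ => (0 : ℝ)) := Measure.map_congr h1
  rw [Measure.map_const] at h2
  simpa using h2

lemma Mt_dichotomy (σ : Measure ℝ) [IsProbabilityMeasure σ] :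
    (∀ z, Mt σ z = 0) ∨ ∀ z ∈ UHP, 0 < (Mt σ z).im := by
  by_cases h : σ {t : ℝ | t ≠ 0} = 0
  · left
    intro z
    rw [eq_dirac_of h, Mt, integral_dirac]
    simp
  · right
    intro z hz
    have hS := UHP_sub_SS hz
    have hz' : 0 < z.im := hz
    rw [Mt_eq σ hS, sub_im, one_im, sub_zero]
    have hp : ∀ t : ℝ, 0 ≤ ((1 - z * (t : ℂ) ^ 2)⁻¹).im := by
      intro t
      rw [kern_im]
      have := kern_nsq hS t
      positivity
    refine int_im_pos (kern_int hS) hp ?_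
    have : {t : ℝ | 0 < ((1 - z * (t : ℂ) ^ 2)⁻¹).im} = {t : ℝ | t ≠ 0} := by
      ext t
      simp only [mem_ofPred_eq]
      rw [kern_im]
      have := kern_nsq hS t
      constructor
      · rintro h rfl
        simp at h
      · intro h
        positivity
    rw [this]
    exact h

lemma zM_im (σ : Measure ℝ) [IsProbabilityMeasure σ] {z : ℂ} (hz : z ∈ UHP) :
    0 < (z * (1 + Mt σ z)).im := by
  have := zNN_im_pos (IsProbabilityMeasure.ne_zero σ) hz
  rw [Mt_eq σ (UHP_sub_SS hz)]
  simpa using this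

lemma zlM_im {l : ℝ} (hl : l ∈ Ioo (0 : ℝ) 1) (σ : Measure ℝ) [IsProbabilityMeasure σ] {z : ℂ}
    (hz : z ∈ UHP) : 0 < (z * (1 + l * Mt σ z)).im := by
  have h1 := zM_im σ hz
  have hz' : 0 < z.im := hz
  have : z * (1 + l * Mt σ z) = ((1 - l : ℝ) : ℂ) * z + (l : ℂ) * (z * (1 + Mt σ z)) := by
    push_cast; ring
  rw [this, add_im, im_ofReal_mul, im_ofReal_mul]
  have h2 := hl.1
  have h3 : 0 < 1 - l := by linarith [hl.2]
  positivity

lemma NN_neg (σ : Measure ℝ) [IsFiniteMeasure σ] {x : ℝ} (hx : x < 0) :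
    NN σ x = ((∫ t, (1 - x * t ^ 2)⁻¹ ∂σ : ℝ) : ℂ) := by
  rw [← integral_complex_ofReal, NN]
  congr 1
  funext t
  push_cast
  rfl

lemma Mt_neg (σ : Measure ℝ) [IsProbabilityMeasure σ] {x : ℝ} (hx : x < 0) :
    ∃ m : ℝ, Mt σ x = m ∧ -1 < m ∧ m ≤ 0 ∧ (m = 0 → σ = Measure.dirac 0) := by
  have hintg : Integrable (fun t : ℝ => (1 - x * t ^ 2)⁻¹) σ := by
    have := imCLM.integrable_comp ((kern_int (σ := σ) (neg_mem_SS hx)).const_mul I)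
    refine this.congr (Eventually.of_forall fun t => ?_)
    have e : (1 - (x : ℂ) * (t : ℂ) ^ 2)⁻¹ = (((1 - x * t ^ 2)⁻¹ : ℝ) : ℂ) := by push_cast; rfl
    simp only [e, imCLM_apply, I_mul_im, ofReal_re]
  have hge : ∀ t : ℝ, 1 ≤ 1 - x * t ^ 2 := fun t => by nlinarith [sq_nonneg t]
  refine ⟨(∫ t, (1 - x * t ^ 2)⁻¹ ∂σ) - 1, ?_, ?_, ?_, ?_⟩
  · rw [Mt_eq σ (neg_mem_SS hx), NN_neg σ hx]; push_cast; rfl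
  · have : 0 < ∫ t, (1 - x * t ^ 2)⁻¹ ∂σ := by
      rw [integral_pos_iff_support_of_nonneg _ hintg]
      · have : Function.support (fun t : ℝ => (1 - x * t ^ 2)⁻¹) = univ := by
          ext t; simp; linarith [hge t]
        rw [this]; simp
      · intro t
        have := hge t
        simp only [Pi.zero_apply]
        positivity
    linarith
  · have : ∫ t, (1 - x * t ^ 2)⁻¹ ∂σ ≤ ∫ _, (1 : ℝ) ∂σ :=
      integral_mono hintg (integrable_const _) fun t => inv_le_one_of_one_le₀ (hge t)
    simp at this
    linarith
  · intro h
    apply eq_dirac_of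
    have h1 : ∫ t, (1 - (1 - x * t ^ 2)⁻¹) ∂σ = 0 := by
      rw [integral_sub (integrable_const _) hintg]; simp; linarith
    have hi2 : Integrable (fun t : ℝ => 1 - (1 - x * t ^ 2)⁻¹) σ := (integrable_const _).sub hintg
    rw [integral_eq_zero_iff_of_nonneg (fun t => by
      have := inv_le_one_of_one_le₀ (hge t)
      simp only [Pi.zero_apply]; linarith) hi2] at h1
    rw [Filter.EventuallyEq, ae_iff] at h1
    refine measure_mono_null (fun t ht => ?_) h1
    simp only [mem_ofPred_eq, Pi.zero_apply]
    intro h2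
    have h3 : (1 - x * t ^ 2)⁻¹ = 1 := by linarith
    have h4 : 1 - x * t ^ 2 = 1 := by simpa using h3
    have h5 : x * t ^ 2 = 0 := by linarith
    rcases mul_eq_zero.1 h5 with h | h
    · linarith
    · exact ht (by simpa using h)

lemma Ht_neg {l : ℝ} (hl : l ∈ Ioo (0 : ℝ) 1) (σ : Measure ℝ) [IsProbabilityMeasure σ] {x : ℝ}
    (hx : x < 0) : ∃ h : ℝ, Ht l σ x = h ∧ h < 0 ∧ x ≤ h := by
  obtain ⟨m, hm, h1, h2, _⟩ := Mt_neg σ hx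
  have hl0 := hl.1
  have hl1 := hl.2
  have ha : 0 < 1 + m := by linarith
  have hb : 0 < 1 + l * m := by nlinarith
  refine ⟨x * (1 + m) * (1 + l * m), by rw [Ht, hm]; push_cast; rfl, ?_, ?_⟩
  · have := mul_pos ha hb
    nlinarith
  · have : (1 + m) * (1 + l * m) ≤ 1 := by
      have h5 : 1 + l * m ≤ 1 := by nlinarith
      nlinarith
    nlinarith

lemma Ht_SS_UHP {l : ℝ} (hl : l ∈ Ioo (0 : ℝ) 1) (σ : Measure ℝ) [IsProbabilityMeasure σ] {z : ℂ}
    (hz : z ∈ UHP) : Ht l σ z ∈ SS := by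
  by_contra hcon
  have hcon' : ¬ ((Ht l σ z).re < 0 ∨ (Ht l σ z).im ≠ 0) := hcon
  push Not at hcon'
  have h1 := zM_im σ hz
  have h2 := zlM_im hl σ hz
  have h3 := Mt_im_nonneg σ hz
  have e : Ht l σ z = (z * (1 + Mt σ z)) * (1 + l * Mt σ z) := rfl
  generalize hagen : z * (1 + Mt σ z) = a at *
  set b := 1 + (l : ℂ) * Mt σ z with hb
  have hbim : 0 ≤ b.im := by
    rw [hb, add_im, im_ofReal_mul, one_im]
    have := hl.1
    positivity
  rw [e, mul_re, mul_im] at hcon'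
  have hb0 : b ≠ 0 := by
    intro h
    rw [h] at h2
    simp at h2
  obtain ⟨h4, h5⟩ := hcon'
  have h6 : normSq a * b.im = - a.im * (a.re * b.re - a.im * b.im) := by
    rw [normSq_apply]; linear_combination (a.re) * h5
  have h7 : 0 < normSq a := by
    rw [normSq_apply]; nlinarith
  have h8 : b.im = 0 := by
    nlinarith
  rw [h8, mul_zero, zero_add] at h5
  have h9 : b.re = 0 := by
    rcases mul_eq_zero.1 h5 with h | h
    · linarith
    · exact h
  exact hb0 (Complex.ext h9 h8)

lemma SS_cases {z : ℂ} (hz : z ∈ SS) :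
    z ∈ UHP ∨ (starRingEnd ℂ) z ∈ UHP ∨ ∃ x : ℝ, x < 0 ∧ z = x := by
  rcases lt_trichotomy z.im 0 with h | h | h
  · right; left; simpa [UHP] using h
  · right; right
    exact ⟨z.re, hz.resolve_right (by simpa using h), Complex.ext (by simp) (by simp [h])⟩
  · left; exact h

lemma Ht_SS {l : ℝ} (hl : l ∈ Ioo (0 : ℝ) 1) (σ : Measure ℝ) [IsProbabilityMeasure σ] {z : ℂ}
    (hz : z ∈ SS) : Ht l σ z ∈ SS := by
  rcases SS_cases hz with h | h | ⟨x, hx, rfl⟩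
  · exact Ht_SS_UHP hl σ h
  · have := SS_conj (Ht_SS_UHP hl σ h)
    rwa [Ht_conj, conj_conj] at this
  · obtain ⟨h, e, h1, _⟩ := Ht_neg hl σ hx
    rw [e]; exact neg_mem_SS h1

lemma rectC_im_pos {G : Measure ℝ} [IsFiniteMeasure G] (h0 : G ≠ 0) {z : ℂ} (hz : z ∈ UHP) :
    0 < (rectC G z).im := by
  have h1 := NN_im_nonneg (σ := G) hz
  have h2 := zNN_im_pos h0 hz
  rw [rectC_eq G (UHP_sub_SS hz), sub_im, ofReal_im, add_mul, one_mul, add_im]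
  linarith

lemma rectC_div_im {G : Measure ℝ} [IsFiniteMeasure G] {z : ℂ} (hz : z ∈ UHP) :
    0 ≤ (rectC G z / z).im := by
  have hS := UHP_sub_SS hz
  have hz' : 0 < z.im := hz
  have hne : z ≠ 0 := by rintro rfl; simp at hz'
  have e : rectC G z / z = ∫ t : ℝ, ((1 - z * (t : ℂ) ^ 2)⁻¹ + (t : ℂ) ^ 2 * (1 - z * (t : ℂ) ^ 2)⁻¹) ∂G := by
    rw [rectC, mul_div_cancel_left₀ _ hne]
    congr 1; funext t; rw [div_eq_mul_inv]; ring
  rw [e]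
  refine int_im_nonneg ((kern_int hS).add (kern_int2 hS)) fun t => ?_
  rw [add_im, ← ofReal_pow, im_ofReal_mul, ofReal_pow, kern_im]
  have := kern_nsq hS t
  positivity

lemma rectC_neg {G : Measure ℝ} [IsFiniteMeasure G] (h0 : G ≠ 0) {x : ℝ} (hx : x < 0) :
    ∃ c : ℝ, rectC G x = c ∧ c < 0 := by
  have e : ∀ t : ℝ, (1 + (t : ℂ) ^ 2) / (1 - (x : ℂ) * (t : ℂ) ^ 2) =
      (((1 + t ^ 2) / (1 - x * t ^ 2) : ℝ) : ℂ) := by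
    intro t; push_cast; rfl
  have hge : ∀ t : ℝ, 1 ≤ 1 - x * t ^ 2 := fun t => by nlinarith [sq_nonneg t]
  have hintg : Integrable (fun t : ℝ => (1 + t ^ 2) / (1 - x * t ^ 2)) G := by
    have := imCLM.integrable_comp (((kern_int (σ := G) (neg_mem_SS hx)).add
      (kern_int2 (σ := G) (neg_mem_SS hx))).const_mul I)
    refine this.congr (Eventually.of_forall fun t => ?_)
    have e2 : (1 - (x : ℂ) * (t : ℂ) ^ 2)⁻¹ + (t : ℂ) ^ 2 * (1 - (x : ℂ) * (t : ℂ) ^ 2)⁻¹ =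
      (((1 + t ^ 2) / (1 - x * t ^ 2) : ℝ) : ℂ) := by rw [← e, div_eq_mul_inv]; ring
    simp only [imCLM_apply, I_mul_im, Pi.add_apply, e2, ofReal_re]
  refine ⟨x * ∫ t, (1 + t ^ 2) / (1 - x * t ^ 2) ∂G, ?_, ?_⟩
  · rw [rectC]
    simp only [e]
    rw [integral_complex_ofReal]
    push_cast; rfl
  · have : 0 < ∫ t, (1 + t ^ 2) / (1 - x * t ^ 2) ∂G := by
      have hpos : ∀ t : ℝ, 0 < (1 + t ^ 2) / (1 - x * t ^ 2) := by
        intro t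
        have := hge t
        positivity
      rw [integral_pos_iff_support_of_nonneg (fun t => (hpos t).le) hintg]
      have : Function.support (fun t : ℝ => (1 + t ^ 2) / (1 - x * t ^ 2)) = univ := by
        ext t; simp only [Function.mem_support, mem_univ, iff_true]; exact (hpos t).ne'
      rw [this, Measure.measure_univ_pos]; exact h0
    nlinarith

lemma rectC_SS {G : Measure ℝ} [IsFiniteMeasure G] (h0 : G ≠ 0) {z : ℂ} (hz : z ∈ SS) :
    rectC G z ∈ SS := by
  rcases SS_cases hz with h | h | ⟨x, hx, rfl⟩
  · exact UHP_sub_SS (rectC_im_pos h0 h)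
  · have := SS_conj (UHP_sub_SS (rectC_im_pos h0 h))
    rwa [rectC_conj, conj_conj] at this
  · obtain ⟨h, e, h1⟩ := rectC_neg h0 hx
    rw [e]; exact neg_mem_SS h1

lemma G_ne_zero {l : ℝ} (hl : l ∈ Ioo (0 : ℝ) 1) (μ : Measure ℝ) [IsProbabilityMeasure μ]
    (hμ0 : μ ≠ Measure.dirac (0 : ℝ)) (G : Measure ℝ) (hID : IsRectInfDiv l μ G) : G ≠ 0 := by
  rintro rfl
  obtain ⟨ε, hε, h⟩ := hID
  have hx : -ε / 2 < 0 := by linarith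
  have h1 := h (-ε / 2) ⟨by linarith, hx⟩
  obtain ⟨m, hm, m1, m2, m3⟩ := Mt_neg μ hx
  have e0 : ∀ z, rectC (0 : Measure ℝ) z = 0 := by intro z; simp [rectC]
  rw [Ht, hm, e0] at h1
  have h2 : (((-ε / 2) * (1 + m) * (1 + l * m) : ℝ) : ℂ) = ((-ε / 2 : ℝ) : ℂ) := by
    rw [Tfun] at h1; push_cast at h1 ⊢; rw [h1]; ring
  have h3 : (-ε / 2) * (1 + m) * (1 + l * m) = -ε / 2 := by exact_mod_cast h2
  have h4 : (1 + m) * (1 + l * m) = 1 := by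
    have : (-ε / 2) * ((1 + m) * (1 + l * m) - 1) = 0 := by linarith
    rcases mul_eq_zero.1 this with h | h <;> linarith
  have hl0 := hl.1
  have hl1 := hl.2
  apply hμ0
  apply m3
  have h5 : m * ((1 + l) + l * m) = 0 := by linarith
  rcases mul_eq_zero.1 h5 with h | h
  · exact h
  · nlinarith

lemma Ht_tendsto (l : ℝ) (σ : Measure ℝ) [IsProbabilityMeasure σ] :
    Tendsto (fun x : ℝ => Ht l σ (x : ℂ)) (𝓝[<] 0) (𝓝 0) := by
  have h1 := Mt_tendsto σ
  have h0 : Tendsto (fun x : ℝ => (x : ℂ)) (𝓝[<] 0) (𝓝 ((0 : ℝ) : ℂ)) :=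
    (continuous_ofReal.tendsto 0).mono_left nhdsWithin_le_nhds
  have := (h0.mul (h1.const_add 1)).mul ((h1.const_mul (l : ℂ)).const_add 1)
  simpa [Ht] using this

lemma plucker (a b s : ℂ) (ha : 0 ≤ a.im) (hb : 0 ≤ b.im)
    (H : (0 < (a * b).im ∧ 0 < s.im ∧ 0 ≤ (s * (starRingEnd ℂ) (a * b)).im) ∨
      ((a * b).im < 0 ∧ s.im < 0 ∧ (s * (starRingEnd ℂ) (a * b)).im ≤ 0)) :
    0 ≤ (s * (starRingEnd ℂ) a).im := by
  have key : (a * b).im * (s * (starRingEnd ℂ) a).im =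
      s.im * (normSq a * b.im) + a.im * (s * (starRingEnd ℂ) (a * b)).im := by
    simp only [mul_im, mul_re, conj_re, conj_im, normSq_apply]
    ring
  have hn := normSq_nonneg a
  rcases H with ⟨h1, h2, h3⟩ | ⟨h1, h2, h3⟩
  · have : 0 ≤ (a * b).im * (s * (starRingEnd ℂ) a).im := by rw [key]; positivity
    exact nonneg_of_mul_nonneg_right this h1
  · have h4 : s.im * (normSq a * b.im) ≤ 0 :=
      mul_nonpos_of_nonpos_of_nonneg h2.le (by positivity)
    have h5 : a.im * (s * (starRingEnd ℂ) (a * b)).im ≤ 0 :=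
      mul_nonpos_of_nonneg_of_nonpos ha h3
    by_contra hcon
    push Not at hcon
    have := mul_pos_of_neg_of_neg h1 hcon
    linarith

lemma div_im_conj (a b : ℂ) : (a / b).im = (a * (starRingEnd ℂ) b).im / normSq b := by
  rw [div_eq_mul_inv, inv_def, ← mul_assoc, im_mul_ofReal, div_eq_mul_inv]

def Trich (h s : ℂ) : Prop :=
  (0 < h.im ∧ 0 < s.im ∧ 0 ≤ (s * (starRingEnd ℂ) h).im) ∨
  (h.im < 0 ∧ s.im < 0 ∧ (s * (starRingEnd ℂ) h).im ≤ 0) ∨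
  (h.im = 0 ∧ h.re < 0 ∧ s.im = 0 ∧ s.re < 0)

lemma Trich_rectC {G : Measure ℝ} [IsFiniteMeasure G] (h0 : G ≠ 0) {h : ℂ} (hS : h ∈ SS) :
    Trich h (rectC G h) := by
  have hU : ∀ w ∈ UHP, 0 < (rectC G w).im ∧ 0 ≤ (rectC G w * (starRingEnd ℂ) w).im := by
    intro w hw
    refine ⟨rectC_im_pos h0 hw, ?_⟩
    have h1 := rectC_div_im (G := G) hw
    have hw' : 0 < w.im := hw
    have hn : 0 < normSq w := by rw [normSq_apply]; nlinarith
    rw [div_im_conj] at h1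
    have := mul_nonneg h1 hn.le
    rwa [div_mul_cancel₀ _ hn.ne'] at this
  rcases SS_cases hS with hh | hh | ⟨x, hx, rfl⟩
  · exact Or.inl ⟨hh, hU h hh⟩
  · right; left
    obtain ⟨h1, h2⟩ := hU _ hh
    rw [rectC_conj] at h1 h2
    have hh' : 0 < ((starRingEnd ℂ) h).im := hh
    simp only [mul_im, conj_re, conj_im] at *
    refine ⟨by linarith, by linarith, by linarith⟩
  · right; right
    obtain ⟨c, e, hc⟩ := rectC_neg h0 hx
    rw [e]
    simp [hx, hc]

lemma lemA {l : ℝ} (hl : l ∈ Ioo (0 : ℝ) 1) {z m s h : ℂ} (hz : 0 < z.im) (hm : 0 < m.im)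
    (h1 : 0 < (z * (1 + m)).im) (h2 : 0 < (z * (1 + l * m)).im)
    (hh : h = z * (1 + m) * (1 + l * m)) (hT : Trich h s) (hm' : 0 ≤ (m - s).im)
    (r : ℝ) (hr : 0 ≤ r) : Tfun l (m - s) ≠ r * h := by
  intro heq
  have hl0 := hl.1
  have hp : (1 + m) ≠ 0 := by rintro h; rw [h] at h1; simp at h1
  have hQ : (1 + l * m) ≠ 0 := by rintro h; rw [h] at h2; simp at h2
  have hz0 : z ≠ 0 := by rintro rfl; simp at hz
  have hlc : (l : ℂ) ≠ 0 := by exact_mod_cast hl0.ne'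
  have hpim : (1 + m).im = m.im := by simp
  have hQim : (1 + l * m).im = l * m.im := by simp
  have hp'im : (m - s + 1).im = (m - s).im := by simp
  have hQ'im : (l * (m - s) + 1).im = l * (m - s).im := by simp
  rcases hr.eq_or_lt with rfl | hr
  · simp only [ofReal_zero, zero_mul, Tfun] at heq
    rcases hT with ⟨a1, a2, a3⟩ | hT
    · rcases mul_eq_zero.1 heq with hk | hk
      · have es : s * l = (1 + l * m) := by linear_combination -hk
        have e2 : s * l * (starRingEnd ℂ) (z * (1 + m) * (1 + l * m)) =
            ((normSq (1 + l * m) : ℝ) : ℂ) * (starRingEnd ℂ) (z * (1 + m)) := by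
          rw [es, normSq_eq_conj_mul_self, map_mul (starRingEnd ℂ) (z * (1 + m))]; ring
        have e3 := congrArg Complex.im e2
        rw [im_ofReal_mul, conj_im, mul_right_comm, im_mul_ofReal, ← hh] at e3
        have : 0 < normSq (1 + l * m) := normSq_pos.2 hQ
        have h5 : 0 ≤ (s * (starRingEnd ℂ) h).im * l := mul_nonneg (by assumption) hl0.le
        nlinarith
      · have es : s = (1 + m) := by linear_combination -hk
        have e2 : s * (starRingEnd ℂ) (z * (1 + m) * (1 + l * m)) =
            ((normSq (1 + m) : ℝ) : ℂ) * (starRingEnd ℂ) (z * (1 + l * m)) := by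
          rw [es, normSq_eq_conj_mul_self]; simp only [map_mul]; ring
        have e3 := congrArg Complex.im e2
        rw [im_ofReal_mul, conj_im, ← hh] at e3
        have : 0 < normSq (1 + m) := normSq_pos.2 hp
        nlinarith
    · have hs : s.im ≤ 0 := by
        rcases hT with h | h
        · exact h.2.1.le
        · exact h.2.2.1.le
      rcases mul_eq_zero.1 heq with h | h
      · have := congrArg Complex.im h
        rw [hQ'im, zero_im, sub_im] at this
        have : m.im - s.im = 0 := by
          rcases mul_eq_zero.1 this with h | h
          · linarith
          · exact h
        linarith
      · have := congrArg Complex.im h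
        rw [hp'im, zero_im, sub_im] at this
        linarith
  · have hrc : (r : ℂ) ≠ 0 := by exact_mod_cast hr.ne'
    have hh0 : h ≠ 0 := by
      rw [hh]; exact mul_ne_zero (mul_ne_zero hz0 hp) hQ
    rw [Tfun] at heq
    have hprod : (l * (m - s) + 1) * (m - s + 1) ≠ 0 := by
      rw [heq]; exact mul_ne_zero hrc hh0
    have hQ'0 : l * (m - s) + 1 ≠ 0 := left_ne_zero_of_mul hprod
    have hp'0 : m - s + 1 ≠ 0 := right_ne_zero_of_mul hprod
    have hinv : (1 / (r * z)).im < 0 := by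
      rw [div_im_conj, one_mul, conj_im, im_ofReal_mul]
      have : 0 < normSq (r * z) := normSq_pos.2 (mul_ne_zero hrc hz0)
      have h3 : 0 < r * z.im := by positivity
      exact div_neg_of_neg_of_pos (by linarith) this
    have hident : 1 / (r * z) = 1 + s * (l * (m - s + 1) + (1 + l * m)) / (r * h) := by
      have e1 : (1 + m) * (1 + l * m) = r * h + s * (l * (m - s + 1) + (1 + l * m)) := by
        rw [← heq]; ring
      have e2 : 1 / (r * z) = (1 + m) * (1 + l * m) / (r * h) := by
        rw [div_eq_div_iff (mul_ne_zero hrc hz0) (mul_ne_zero hrc hh0), hh]; ring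
      rw [e2, e1, add_div, div_self (mul_ne_zero hrc hh0)]
    have main : 0 ≤ (s * (l * (m - s + 1) + (1 + l * m)) / (r * h)).im := by
      by_cases hc : h.im = 0
      · have hT' : h.re < 0 ∧ s.im = 0 ∧ s.re < 0 := by
          rcases hT with h | h | h
          · linarith [h.1]
          · linarith [h.1]
          · exact h.2
        have eh : h = (h.re : ℂ) := Complex.ext (by simp) (by simp [hc])
        have es : s = (s.re : ℂ) := Complex.ext (by simp) (by simp [hT'.2.1])
        have e : s * (l * (m - s + 1) + (1 + l * m)) / (r * h) =
            ((s.re / (r * h.re) : ℝ) : ℂ) * (l * (m - s + 1) + (1 + l * m)) := by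
          push_cast
          rw [← eh, ← es]; ring
        rw [e, im_ofReal_mul]
        apply mul_nonneg
        · apply div_nonneg_of_nonpos hT'.2.2.le
          exact (mul_neg_of_pos_of_neg hr hT'.1).le
        · rw [add_im, im_ofReal_mul, hp'im, hQim]
          positivity
      · have e : s * (l * (m - s + 1) + (1 + l * m)) / (r * h) =
            l * (s / (l * (m - s) + 1)) + ((1 / r : ℝ) : ℂ) * (s / (z * (1 + m))) := by
          rw [mul_add, add_div]
          congr 1
          · rw [← heq]; field_simp
          · rw [hh]; push_cast; field_simp
        rw [e, add_im, im_ofReal_mul, im_ofReal_mul, div_im_conj, div_im_conj]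
        have p1 : 0 ≤ (s * (starRingEnd ℂ) (l * (m - s) + 1)).im := by
          apply plucker _ (m - s + 1) _ (by rw [hQ'im]; positivity) (by rw [hp'im]; exact hm')
          rw [heq]
          have e5 : s * (starRingEnd ℂ) (r * h) = r * (s * (starRingEnd ℂ) h) := by
            simp; ring
          rw [e5, im_ofReal_mul, im_ofReal_mul]
          rcases hT with ⟨h, h', h''⟩ | ⟨h, h', h''⟩ | h
          · left; exact ⟨by positivity, h', by positivity⟩
          · right; exact ⟨by nlinarith, h', by nlinarith⟩
          · exact absurd h.1 hc
        have p2 : 0 ≤ (s * (starRingEnd ℂ) (z * (1 + m))).im := by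
          apply plucker _ (1 + l * m) _ h1.le (by rw [hQim]; positivity)
          rw [← hh]
          rcases hT with h | h | h
          · left; exact h
          · right; exact h
          · exact absurd h.1 hc
        have n1 := normSq_nonneg ((l : ℂ) * (m - s) + 1)
        have n2 := normSq_nonneg (z * (1 + m))
        positivity
    rw [hident, add_im, one_im, zero_add] at hinv
    linarith

def mp (l : ℝ) (G ρ : Measure ℝ) (z : ℂ) : ℂ := Mt ρ z - rectC G (Ht l ρ z)

def om (l : ℝ) (G ρ : Measure ℝ) (z : ℂ) : ℂ := Ht l ρ z / Tfun l (mp l G ρ z)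

lemma Tfun_diff (l : ℝ) : Differentiable ℂ (Tfun l) := by
  unfold Tfun; fun_prop


lemma mp_diff {l : ℝ} (hl : l ∈ Ioo (0 : ℝ) 1) {G : Measure ℝ} [IsFiniteMeasure G]
    (ρ : Measure ℝ) [IsProbabilityMeasure ρ] : DifferentiableOn ℂ (mp l G ρ) SS := by
  unfold mp
  exact (Mt_diff ρ).sub ((rectC_diff G).comp (Ht_diff l ρ) (fun z hz => Ht_SS hl ρ hz))

lemma om_diffAt {l : ℝ} (hl : l ∈ Ioo (0 : ℝ) 1) {G : Measure ℝ} [IsFiniteMeasure G]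
    (ρ : Measure ℝ) [IsProbabilityMeasure ρ] {z : ℂ} (hz : z ∈ SS) (hD : Tfun l (mp l G ρ z) ≠ 0) :
    DifferentiableAt ℂ (om l G ρ) z := by
  have h1 := (Ht_diff l ρ).differentiableAt (SS_open.mem_nhds hz)
  have h2 := (mp_diff hl (G := G) ρ).differentiableAt (SS_open.mem_nhds hz)
  exact h1.div ((Tfun_diff l _).comp z h2) hD

lemma om_neg {l : ℝ} (hl : l ∈ Ioo (0 : ℝ) 1) {G : Measure ℝ} [IsFiniteMeasure G]
    (h0 : G ≠ 0) (ρ : Measure ℝ) [IsProbabilityMeasure ρ]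
    {x : ℝ} (hx : x < 0) : ∃ k m : ℝ, om l G ρ x = k ∧ k < 0 ∧ mp l G ρ x = m ∧ -1 < m ∧
    Tfun l (mp l G ρ x) ≠ 0 := by
  obtain ⟨m, e1, hm, -⟩ := Mt_neg ρ hx
  obtain ⟨h, e2, hh, -⟩ := Ht_neg hl ρ hx
  obtain ⟨c, e3, hc⟩ := rectC_neg h0 hh
  have e : mp l G ρ x = ((m - c : ℝ) : ℂ) := by
    rw [mp, e1, e2, e3]; push_cast; rfl
  have hm1 : -1 < m - c := by linarith
  have eT : Tfun l (mp l G ρ x) = (((l * (m - c) + 1) * (m - c + 1) : ℝ) : ℂ) := by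
    rw [e, Tfun]; push_cast; rfl
  have hT : 0 < (l * (m - c) + 1) * (m - c + 1) := by
    have := hl.1; have := hl.2
    apply mul_pos <;> nlinarith
  refine ⟨h / ((l * (m - c) + 1) * (m - c + 1)), m - c, ?_, div_neg_of_neg_of_pos hh hT, e, hm1, ?_⟩
  · rw [om, e2, eT]; push_cast; rfl
  · rw [eT]; exact_mod_cast hT.ne'

lemma T_inj {l : ℝ} (hl : l ∈ Ioo (0 : ℝ) 1) {n m : ℝ} (hn : -1 < n) (hm : -1 < m) (h : Tfun l n = Tfun l m) : n = m := by
  have h' : (l * n + 1) * (n + 1) = (l * m + 1) * (m + 1) := by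
    simp only [Tfun] at h; exact_mod_cast h
  have h2 : (n - m) * (l * (n + m) + 1 + l) = 0 := by linear_combination h'
  rcases mul_eq_zero.1 h2 with h | h
  · linarith
  · have := hl.1; have := hl.2; nlinarith

lemma om_neg_eq {l : ℝ} (hl : l ∈ Ioo (0 : ℝ) 1) {G : Measure ℝ} [IsFiniteMeasure G]
    (h0 : G ≠ 0) (ρ : Measure ℝ) [IsProbabilityMeasure ρ]
    (ν : Measure ℝ) [IsProbabilityMeasure ν] {x : ℝ} (hx : x < 0)
    (hE : Ht l ρ x = Ht l ν (om l G ρ x)) : Mt ν (om l G ρ x) = mp l G ρ x := by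
  obtain ⟨k, m, e1, hk, e2, hm, hD⟩ := om_neg hl h0 ρ hx
  obtain ⟨n, e3, hn, -⟩ := Mt_neg ν hk
  have h1 : Ht l ρ x = om l G ρ x * Tfun l (mp l G ρ x) := by
    rw [om, div_mul_cancel₀ _ hD]
  rw [h1, Ht_eq, e1, e3, e2] at hE
  have hk' : (k : ℂ) ≠ 0 := by exact_mod_cast hk.ne
  have := T_inj hl hm hn (mul_left_cancel₀ hk' hE)
  rw [e1, e2, e3, this]

lemma om_tendsto {l : ℝ} (hl : l ∈ Ioo (0 : ℝ) 1) {G : Measure ℝ} [IsFiniteMeasure G]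
    (ρ : Measure ℝ) [IsProbabilityMeasure ρ] : Tendsto (fun x : ℝ => om l G ρ x) (𝓝[<] 0) (𝓝 0) := by
  have h1 := Ht_tendsto l ρ
  have h2 : Tendsto (fun x : ℝ => (Ht l ρ x).re) (𝓝[<] 0) (𝓝[<] 0) := by
    apply tendsto_nhdsWithin_iff.2 ⟨?_, ?_⟩
    · have := (continuous_re.tendsto 0).comp h1
      simpa [Function.comp_def] using this
    · filter_upwards [self_mem_nhdsWithin] with x hx
      obtain ⟨h, e2, hh, -⟩ := Ht_neg hl ρ hx
      rw [e2]; exact hh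
  have h3 : Tendsto (fun x : ℝ => rectC G (Ht l ρ x)) (𝓝[<] 0) (𝓝 0) := by
    refine ((rectC_tendsto G).comp h2).congr' ?_
    filter_upwards [self_mem_nhdsWithin] with x hx
    obtain ⟨h, e2, hh, -⟩ := Ht_neg hl ρ hx
    simp [e2]
  have h4 : Tendsto (fun x : ℝ => Tfun l (mp l G ρ x)) (𝓝[<] 0) (𝓝 (Tfun l (0 - 0))) :=
    ((Tfun_diff l).continuous.tendsto _).comp ((Mt_tendsto ρ).sub h3)
  have := h1.div h4 (by simp [Tfun])
  have h5 : (0 : ℂ) / Tfun l (0 - 0) = 0 := by simp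
  rw [h5] at this
  exact this

lemma exists_start {l : ℝ} (hl : l ∈ Ioo (0 : ℝ) 1) {G : Measure ℝ} [IsFiniteMeasure G]
    (h0 : G ≠ 0) (ρ : Measure ℝ) [IsProbabilityMeasure ρ]
    (ν : Measure ℝ) [IsProbabilityMeasure ν] (hc : IsRectConv l G ν ρ) :
    ∃ x₀ : ℝ, x₀ < 0 ∧ (∀ᶠ w in 𝓝 (x₀ : ℂ), Mt ν (om l G ρ w) = mp l G ρ w) ∧
      ∀ᶠ y : ℝ in 𝓝[>] 0, om l G ρ (x₀ + y * I) ∈ UHP := by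
  obtain ⟨ε, hε, hc⟩ := hc
  have hder : ∀ x : ℝ, x < 0 → HasDerivAt (om l G ρ) (deriv (om l G ρ) x) x := by
    intro x hx
    obtain ⟨k, m, e1, hk, e2, hm, hD⟩ := om_neg hl h0 ρ hx
    exact (om_diffAt hl ρ (neg_mem_SS hx) hD).hasDerivAt
  have hderR : ∀ x : ℝ, x < 0 →
      HasDerivAt (fun t : ℝ => (om l G ρ t).re) (deriv (om l G ρ) x).re x :=
    fun x hx => (hder x hx).real_of_complex
  have hx1 : -(ε/2) < 0 := by linarith
  obtain ⟨k1, m1, e1, hk1, -⟩ := om_neg hl h0 ρ hx1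
  have hx2 : ∀ᶠ x : ℝ in 𝓝[<] 0, k1 < (om l G ρ x).re := by
    have := (continuous_re.tendsto 0).comp (om_tendsto hl (G := G) ρ)
    exact this.eventually (lt_mem_nhds (by simpa using hk1))
  have hx3 : ∀ᶠ x : ℝ in 𝓝[<] 0, x ∈ Ioo (-(ε/2)) 0 := Ioo_mem_nhdsLT hx1
  obtain ⟨x2, h2, h3⟩ := (hx2.and hx3).exists
  obtain ⟨x0, hx0, hd⟩ := exists_hasDerivAt_eq_slope (fun t : ℝ => (om l G ρ t).re)
    (fun t : ℝ => (deriv (om l G ρ) t).re) h3.1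
    (fun t ht => (hderR t (lt_of_le_of_lt ht.2 h3.2)).continuousAt.continuousWithinAt)
    (fun t ht => hderR t (lt_trans ht.2 h3.2))
  have hx0n : x0 < 0 := lt_trans hx0.2 h3.2
  have hdpos : 0 < (deriv (om l G ρ) x0).re := by
    rw [hd]
    apply div_pos
    · rw [e1]; simpa using h2
    · linarith [h3.1]
  obtain ⟨k, m, f1, hk, f2, hm, hD⟩ := om_neg hl h0 ρ hx0n
  refine ⟨x0, hx0n, ?_, ?_⟩
  · have hDo : ∀ᶠ w in 𝓝 (x0 : ℂ), w ∈ SS ∧ Tfun l (mp l G ρ w) ≠ 0 ∧ om l G ρ w ∈ SS := by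
      have c1 : ContinuousAt (fun w => Tfun l (mp l G ρ w)) (x0 : ℂ) :=
        (((Tfun_diff l) _).comp (x0 : ℂ) ((mp_diff hl (G := G) ρ).differentiableAt
          (SS_open.mem_nhds (neg_mem_SS hx0n)))).continuousAt
      have c2 := (om_diffAt hl ρ (neg_mem_SS hx0n) hD).continuousAt
      filter_upwards [SS_open.mem_nhds (neg_mem_SS hx0n), c1.eventually_ne hD,
        c2.preimage_mem_nhds (SS_open.mem_nhds (by rw [f1]; exact neg_mem_SS hk))] with w a b c
      exact ⟨a, b, c⟩
    have a1 : AnalyticAt ℂ (fun w => Mt ν (om l G ρ w)) (x0 : ℂ) := by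
      rw [analyticAt_iff_eventually_differentiableAt]
      filter_upwards [hDo] with w ⟨p1, p2, p3⟩
      exact ((Mt_diff ν).differentiableAt (SS_open.mem_nhds p3)).comp w (om_diffAt hl ρ p1 p2)
    have a2 : AnalyticAt ℂ (mp l G ρ) (x0 : ℂ) := by
      rw [analyticAt_iff_eventually_differentiableAt]
      filter_upwards [hDo] with w ⟨p1, p2, p3⟩
      exact (mp_diff hl ρ).differentiableAt (SS_open.mem_nhds p1)
    apply (AnalyticAt.frequently_eq_iff_eventually_eq a1 a2).1
    have t : Tendsto (fun t : ℝ => (t : ℂ)) (𝓝[≠] x0) (𝓝[≠] (x0 : ℂ)) := by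
      apply tendsto_nhdsWithin_iff.2 ⟨?_, ?_⟩
      · exact (continuous_ofReal.tendsto x0).mono_left nhdsWithin_le_nhds
      · filter_upwards [self_mem_nhdsWithin] with t ht
        simpa using ht
    apply t.frequently
    apply Eventually.frequently
    apply mem_nhdsWithin_of_mem_nhds
    have : Ioo (-ε) 0 ∈ 𝓝 x0 := Ioo_mem_nhds (by linarith [hx0.1]) hx0n
    filter_upwards [this] with t ht
    exact om_neg_eq hl h0 ρ ν ht.2 (hc t ht).2
  · have hline : HasDerivAt (fun y : ℝ => (x0 : ℂ) + y * I) I 0 := by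
      have := ((hasDerivAt_id (0:ℝ)).ofReal_comp.mul_const I).const_add (x0 : ℂ)
      simpa using this
    have hcomp : HasDerivAt (fun y : ℝ => om l G ρ ((x0 : ℂ) + y * I))
        (deriv (om l G ρ) x0 * I) 0 := by
      have : HasDerivAt (om l G ρ) (deriv (om l G ρ) x0) ((x0 : ℂ) + ((0:ℝ):ℂ) * I) := by
        simpa using hder x0 hx0n
      exact this.comp (0:ℝ) hline
    have him : HasDerivAt (fun y : ℝ => (om l G ρ ((x0 : ℂ) + y * I)).im)
        (deriv (om l G ρ) x0).re 0 := by
      have := imCLM.hasFDerivAt.comp_hasDerivAt (0:ℝ) hcomp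
      have e : imCLM (deriv (om l G ρ) x0 * I) = (deriv (om l G ρ) x0).re := by simp
      rw [e] at this
      exact this
    have hs := hasDerivAt_iff_tendsto_slope.1 him
    have hs2 : ∀ᶠ y : ℝ in 𝓝[>] 0, 0 < slope (fun y : ℝ => (om l G ρ ((x0 : ℂ) + y * I)).im) 0 y :=
      (hs.mono_left (nhdsWithin_mono _ (fun y hy => (ne_of_gt hy)))).eventually (lt_mem_nhds hdpos)
    filter_upwards [hs2, self_mem_nhdsWithin] with y hy hy0
    rw [slope_def_field] at hy
    simp only [ofReal_zero, zero_mul, add_zero, f1, ofReal_im, sub_zero] at hy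
    exact (div_pos_iff_of_pos_right hy0).1 hy

lemma subord {l : ℝ} (hl : l ∈ Ioo (0 : ℝ) 1) {G : Measure ℝ} [IsFiniteMeasure G] (h0 : G ≠ 0)
    (ρ : Measure ℝ) [IsProbabilityMeasure ρ] (ν : Measure ℝ) [IsProbabilityMeasure ν]
    (hc : IsRectConv l G ν ρ) (hM : ∀ z ∈ UHP, 0 < (Mt ρ z).im) :
    ∀ z ∈ UHP, Tfun l (mp l G ρ z) ≠ 0 ∧ om l G ρ z ∈ UHP ∧ Mt ν (om l G ρ z) = mp l G ρ z := by
  set Ω : Set ℂ := {z | z ∈ UHP ∧ om l G ρ z ∈ UHP ∧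
    ∀ᶠ w in 𝓝 z, Mt ν (om l G ρ w) = mp l G ρ w} with hΩ
  have hD : ∀ z, om l G ρ z ∈ UHP → Tfun l (mp l G ρ z) ≠ 0 := by
    intro z hz h
    rw [om, h, div_zero] at hz
    exact absurd hz (by simp [UHP])
  have hcont : ∀ z ∈ UHP, Tfun l (mp l G ρ z) ≠ 0 → ContinuousAt (om l G ρ) z :=
    fun z hz h => (om_diffAt hl ρ (UHP_sub_SS hz) h).continuousAt
  have hmp : ∀ z ∈ UHP, DifferentiableAt ℂ (mp l G ρ) z :=
    fun z hz => (mp_diff hl ρ).differentiableAt (SS_open.mem_nhds (UHP_sub_SS hz))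
  have hΩo : IsOpen Ω := by
    rw [isOpen_iff_mem_nhds]
    rintro z ⟨h1, h2, h3⟩
    filter_upwards [UHP_open.mem_nhds h1,
      (hcont z h1 (hD z h2)).preimage_mem_nhds (UHP_open.mem_nhds h2),
      eventually_eventually_nhds.2 h3] with w a b c
    exact ⟨a, b, c⟩
  have hne : (UHP ∩ Ω).Nonempty := by
    obtain ⟨x0, hx0, h1, h2⟩ := exists_start hl h0 ρ ν hc
    have t : Tendsto (fun y : ℝ => (x0 : ℂ) + y * I) (𝓝[>] 0) (𝓝 (x0 : ℂ)) := by
      have : Continuous (fun y : ℝ => (x0 : ℂ) + y * I) := by fun_prop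
      have := (this.tendsto 0).mono_left (nhdsWithin_le_nhds (s := Ioi (0:ℝ)))
      simpa using this
    have h3 := t.eventually (eventually_eventually_nhds.2 h1)
    obtain ⟨y, a, b, c⟩ := (h3.and (h2.and self_mem_nhdsWithin)).exists
    have hy : (x0 : ℂ) + y * I ∈ UHP := by
      have : 0 < y := c
      simp [UHP, this]
    exact ⟨_, hy, hy, b, a⟩
  have hcl : closure Ω ∩ UHP ⊆ Ω := by
    rintro z ⟨hzc, hz⟩
    by_contra hzn
    haveI : (𝓝[Ω] z).NeBot := mem_closure_iff_nhdsWithin_neBot.1 hzc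
    have hself : ∀ᶠ w in 𝓝[Ω] z, w ∈ Ω := self_mem_nhdsWithin
    have hmpt : Tendsto (mp l G ρ) (𝓝[Ω] z) (𝓝 (mp l G ρ z)) :=
      (hmp z hz).continuousAt.tendsto.mono_left nhdsWithin_le_nhds
    have himm : 0 ≤ (mp l G ρ z).im := by
      refine ge_of_tendsto ((continuous_im.tendsto _).comp hmpt) ?_
      filter_upwards [hself] with w hw
      have := Mt_im_nonneg ν hw.2.1
      rw [hw.2.2.self_of_nhds] at this
      exact this
    have hzS := UHP_sub_SS hz
    have hT := Trich_rectC h0 (Ht_SS hl ρ hzS)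
    have hA := lemA hl hz (hM z hz) (zM_im ρ hz) (zlM_im hl ρ hz) rfl hT himm
    have hDz : Tfun l (mp l G ρ z) ≠ 0 := by
      have := hA 0 le_rfl
      simpa [mp] using this
    have hhD : Ht l ρ z = om l G ρ z * Tfun l (mp l G ρ z) := by
      rw [om, div_mul_cancel₀ _ hDz]
    have homt : Tendsto (om l G ρ) (𝓝[Ω] z) (𝓝 (om l G ρ z)) :=
      (hcont z hz hDz).tendsto.mono_left nhdsWithin_le_nhds
    have hio : 0 ≤ (om l G ρ z).im := by
      refine ge_of_tendsto ((continuous_im.tendsto _).comp homt) ?_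
      filter_upwards [hself] with w hw
      exact le_of_lt hw.2.1
    have hoU : om l G ρ z ∈ UHP := by
      rcases hio.lt_or_eq with h | h
      · exact h
      exfalso
      obtain ⟨κ, hκ⟩ : ∃ κ : ℝ, om l G ρ z = κ :=
        ⟨(om l G ρ z).re, Complex.ext (by simp) (by simp [← h])⟩
      rcases lt_trichotomy κ 0 with hk | hk | hk
      · have hkS := neg_mem_SS hk
        have c1 : Tendsto (fun w => Mt ν (om l G ρ w)) (𝓝[Ω] z) (𝓝 (Mt ν κ)) := by
          have c2 : ContinuousAt (Mt ν) (κ : ℂ) :=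
            ((Mt_diff ν).differentiableAt (SS_open.mem_nhds hkS)).continuousAt
          rw [hκ] at homt
          exact c2.tendsto.comp homt
        have e1 : Mt ν κ = mp l G ρ z := by
          refine tendsto_nhds_unique c1 (hmpt.congr' ?_)
          filter_upwards [hself] with w hw
          exact hw.2.2.self_of_nhds.symm
        obtain ⟨n, e2, -⟩ := Mt_neg ν hk
        have e3 : mp l G ρ z = n := by rw [← e1, e2]
        have e4 : Ht l ρ z = ((κ * ((l * n + 1) * (n + 1)) : ℝ) : ℂ) := by
          rw [hhD, hκ, e3, Tfun]; push_cast; rfl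
        have hhS := Ht_SS hl ρ hzS
        rw [e4] at hhS
        have hneg : κ * ((l * n + 1) * (n + 1)) < 0 := by
          rcases hhS with h | h
          · simpa only [ofReal_re] using h
          · exact absurd (ofReal_im _) h
        obtain ⟨c, e5, -⟩ := rectC_neg h0 hneg
        have e6 : Mt ρ z = ((n + c : ℝ) : ℂ) := by
          have : Mt ρ z = mp l G ρ z + rectC G (Ht l ρ z) := by rw [mp]; ring
          rw [this, e3, e4, e5]; push_cast; rfl
        have := hM z hz
        rw [e6, ofReal_im] at this
        exact lt_irrefl _ this
      · have := Ht_SS hl ρ hzS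
        rw [hhD, hκ, hk] at this
        simp [SS] at this
      · apply hA (1 / κ) (by positivity)
        have hkc : (κ : ℂ) ≠ 0 := by exact_mod_cast hk.ne'
        change Tfun l (mp l G ρ z) = ((1 / κ : ℝ) : ℂ) * Ht l ρ z
        rw [hhD, hκ]; push_cast
        rw [← mul_assoc, one_div, inv_mul_cancel₀ hkc, one_mul]
    apply hzn
    refine ⟨hz, hoU, ?_⟩
    have hDo : ∀ᶠ w in 𝓝 z, w ∈ UHP ∧ Tfun l (mp l G ρ w) ≠ 0 ∧ om l G ρ w ∈ SS := by
      filter_upwards [UHP_open.mem_nhds hz,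
        (hcont z hz hDz).preimage_mem_nhds (UHP_open.mem_nhds hoU)] with w a c
      exact ⟨a, hD w c, UHP_sub_SS c⟩
    have a1 : AnalyticAt ℂ (fun w => Mt ν (om l G ρ w)) z := by
      rw [analyticAt_iff_eventually_differentiableAt]
      filter_upwards [hDo] with w ⟨p1, p2, p3⟩
      exact ((Mt_diff ν).differentiableAt (SS_open.mem_nhds p3)).comp w
        (om_diffAt hl ρ (UHP_sub_SS p1) p2)
    have a2 : AnalyticAt ℂ (mp l G ρ) z := by
      rw [analyticAt_iff_eventually_differentiableAt]
      filter_upwards [hDo] with w ⟨p1, p2, p3⟩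
      exact hmp w p1
    apply (AnalyticAt.frequently_eq_iff_eventually_eq a1 a2).1
    have hle : 𝓝[Ω] z ≤ 𝓝[≠] z := nhdsWithin_mono z (fun w hw h => hzn (by
      rw [mem_singleton_iff] at h; rwa [h] at hw))
    refine Frequently.filter_mono (Eventually.frequently ?_) hle
    filter_upwards [hself] with w hw
    exact hw.2.2.self_of_nhds
  have hsub := UHP_convex.isPreconnected.subset_of_closure_inter_subset hΩo hne hcl
  intro z hz
  obtain ⟨-, h2, h3⟩ := hsub hz
  exact ⟨hD z h2, h2, h3.self_of_nhds⟩

lemma norm_add_I {m : ℂ} (hm : 0 ≤ m.im) : ‖m‖ ≤ ‖m + I‖ ∧ 1 ≤ ‖m + I‖ := by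
  have h1 : ‖m + I‖ ^ 2 = m.re ^ 2 + (m.im + 1) ^ 2 := by
    rw [Complex.sq_norm, normSq_apply]; simp; ring
  have h2 : ‖m‖ ^ 2 = m.re ^ 2 + m.im ^ 2 := by
    rw [Complex.sq_norm, normSq_apply]; ring
  constructor
  · apply abs_le_of_sq_le_sq' _ (norm_nonneg _) |>.2
    nlinarith
  · apply abs_le_of_sq_le_sq' _ (norm_nonneg _) |>.2
    nlinarith [sq_nonneg m.re]

lemma add_I_ne {m : ℂ} (hm : 0 ≤ m.im) : m + I ≠ 0 := by
  intro h
  have := (norm_add_I hm).2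
  rw [h, norm_zero] at this
  linarith

def sqb (c : ℂ) : ℂ := exp (log (-c) / 2)

lemma sqb_sq {c : ℂ} (hc : c ∈ SS) : sqb c ^ 2 = -c := by
  have h0 : -c ≠ 0 := by
    intro h
    have : c = 0 := by simpa using h
    rw [this] at hc; simp [SS] at hc
  rw [sqb, ← exp_nat_mul]
  have : ((2 : ℕ) : ℂ) * (log (-c) / 2) = log (-c) := by push_cast; ring
  rw [this, exp_log h0]

lemma sqb_re (c : ℂ) : 0 ≤ (sqb c).re := by
  rw [sqb, exp_re]
  apply mul_nonneg (Real.exp_pos _).le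
  have h : (log (-c) / 2).im = arg (-c) / 2 := by
    have : (log (-c) / 2) = log (-c) / ((2 : ℝ) : ℂ) := by push_cast; rfl
    rw [this, div_ofReal_im, log_im]
  rw [h]
  apply Real.cos_nonneg_of_neg_pi_div_two_le_of_le
  · linarith [neg_pi_lt_arg (-c)]
  · linarith [arg_le_pi (-c)]

lemma sqb_bound {c : ℂ} (hc : c ∈ SS) : 1 + ‖c‖ ≤ ‖1 + sqb c‖ ^ 2 ∧ 1 ≤ ‖1 + sqb c‖ := by
  have h1 : ‖c‖ = ‖sqb c‖ ^ 2 := by rw [← norm_pow, sqb_sq hc, norm_neg]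
  have hr := sqb_re c
  have e : ‖1 + sqb c‖ ^ 2 = 1 + 2 * (sqb c).re + ‖sqb c‖ ^ 2 := by
    rw [Complex.sq_norm, Complex.sq_norm, normSq_apply, normSq_apply]; simp; ring
  refine ⟨by rw [h1, e]; linarith, ?_⟩
  apply abs_le_of_sq_le_sq' _ (norm_nonneg _) |>.2
  nlinarith [sq_nonneg ‖sqb c‖]

lemma sqb_diffAt {c : ℂ} (hc : c ∈ SS) : DifferentiableAt ℂ sqb c := by
  have hs : -c ∈ slitPlane := by
    rcases hc with h | h
    · left; simpa using h
    · right; simpa using h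
  unfold sqb
  exact (((differentiableAt_id.neg).clog hs).div_const 2).cexp

lemma T_bound {l : ℝ} (hl : l ∈ Ioo (0 : ℝ) 1) (m : ℂ) : ‖Tfun l m‖ ≤ (‖m‖ + 1) ^ 2 := by
  rw [Tfun, norm_mul, sq]
  have h1 : ‖(l : ℂ) * m + 1‖ ≤ ‖m‖ + 1 := by
    refine (norm_add_le _ _).trans ?_
    rw [norm_mul, norm_one, norm_real, Real.norm_of_nonneg hl.1.le]
    nlinarith [hl.2, norm_nonneg m]
  have h2 : ‖m + 1‖ ≤ ‖m‖ + 1 := by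
    refine (norm_add_le _ _).trans ?_
    rw [norm_one]
  exact mul_le_mul h1 h2 (norm_nonneg _) (by positivity)

lemma T_conj (l : ℝ) (m : ℂ) : Tfun l ((starRingEnd ℂ) m) = (starRingEnd ℂ) (Tfun l m) := by
  simp [Tfun]

lemma CH_tendsto {l : ℝ} (hl : l ∈ Ioo (0 : ℝ) 1) (G : Measure ℝ) [IsFiniteMeasure G]
    (ρ : Measure ℝ) [IsProbabilityMeasure ρ] :
    Tendsto (fun x : ℝ => rectC G (Ht l ρ x)) (𝓝[<] 0) (𝓝 0) := by
  have h1 := Ht_tendsto l ρ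
  have h2 : Tendsto (fun x : ℝ => (Ht l ρ x).re) (𝓝[<] 0) (𝓝[<] 0) := by
    apply tendsto_nhdsWithin_iff.2 ⟨?_, ?_⟩
    · have := (continuous_re.tendsto 0).comp h1
      simpa [Function.comp_def] using this
    · filter_upwards [self_mem_nhdsWithin] with x hx
      obtain ⟨h, e2, hh, -⟩ := Ht_neg hl ρ hx
      rw [e2]; exact hh
  refine ((rectC_tendsto G).comp h2).congr' ?_
  filter_upwards [self_mem_nhdsWithin] with x hx
  obtain ⟨h, e2, hh, -⟩ := Ht_neg hl ρ hx
  simp [e2]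

lemma om_limit {l : ℝ} (hl : l ∈ Ioo (0 : ℝ) 1) {G : Measure ℝ} [IsFiniteMeasure G] (h0 : G ≠ 0)
    (ρ : Measure ℝ) [IsProbabilityMeasure ρ] (ν : Measure ℝ) [IsProbabilityMeasure ν]
    (hS : ∀ z ∈ UHP, Tfun l (mp l G ρ z) ≠ 0 ∧ om l G ρ z ∈ UHP ∧
      Mt ν (om l G ρ z) = mp l G ρ z) {x : ℝ} (hx : 0 < x) :
    ∃ L : OnePoint ℂ, Tendsto (fun z => (om l G ρ z : OnePoint ℂ)) (𝓝[UHP] (x : ℂ)) (𝓝 L) := by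
  have hCH : DifferentiableOn ℂ (fun w => rectC G (Ht l ν w)) SS :=
    (rectC_diff G).comp (Ht_diff l ν) (fun w hw => Ht_SS hl ν hw)
  have hd1 : DifferentiableOn ℂ (fun w => Tfun l (Mt ν w)) SS :=
    (Tfun_diff l).comp_differentiableOn (Mt_diff ν)
  have hd2 : DifferentiableOn ℂ (fun w => Tfun l (Mt ν w + rectC G (Ht l ν w))) SS :=
    (Tfun_diff l).comp_differentiableOn ((Mt_diff ν).add hCH)
  have hP : DifferentiableOn ℂ (fun w => w * Tfun l (Mt ν w)
      - x * Tfun l (Mt ν w + rectC G (Ht l ν w))) SS :=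
    (differentiableOn_id.mul hd1).sub (hd2.const_mul _)
  have hCS : ∀ w ∈ UHP, rectC G (Ht l ν w) ∈ SS :=
    fun w hw => rectC_SS h0 (Ht_SS hl ν (UHP_sub_SS hw))
  have hconjT : ∀ w : ℂ, Tfun l (Mt ν ((starRingEnd ℂ) w) + rectC G (Ht l ν ((starRingEnd ℂ) w))) =
      (starRingEnd ℂ) (Tfun l (Mt ν w + rectC G (Ht l ν w))) := by
    intro w
    rw [Mt_conj, Ht_conj, rectC_conj, ← map_add, T_conj]
  have hden0 : ∀ w ∈ UHP, (w + I) * (Mt ν w + I) ^ 2 * (1 + sqb (rectC G (Ht l ν w))) ^ 4 ≠ 0 := by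
    intro w hw
    have h1 : w + I ≠ 0 := add_I_ne (le_of_lt hw)
    have h2 : Mt ν w + I ≠ 0 := add_I_ne (Mt_im_nonneg ν hw)
    have h3 : 1 + sqb (rectC G (Ht l ν w)) ≠ 0 := by
      intro h
      have := (sqb_bound (hCS w hw)).2
      rw [h, norm_zero] at this; linarith
    exact mul_ne_zero (mul_ne_zero h1 (pow_ne_zero _ h2)) (pow_ne_zero _ h3)
  have key : ∀ w ∈ UHP, ‖Tfun l (Mt ν w)‖ ≤ 4 * ‖Mt ν w + I‖ ^ 2 ∧
      ‖Tfun l (Mt ν w + rectC G (Ht l ν w))‖ ≤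
        4 * ‖Mt ν w + I‖ ^ 2 * ‖1 + sqb (rectC G (Ht l ν w))‖ ^ 4 := by
    intro w hw
    obtain ⟨a1, a2⟩ := norm_add_I (Mt_im_nonneg ν hw)
    obtain ⟨b1, b2⟩ := sqb_bound (hCS w hw)
    have hm := norm_nonneg (Mt ν w)
    have hcn := norm_nonneg (rectC G (Ht l ν w))
    constructor
    · refine (T_bound hl _).trans ?_
      calc (‖Mt ν w‖ + 1) ^ 2 ≤ (2 * ‖Mt ν w + I‖) ^ 2 := by gcongr; linarith
        _ = _ := by ring
    · refine (T_bound hl _).trans ?_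
      have h1 : ‖Mt ν w + rectC G (Ht l ν w)‖ + 1 ≤
          2 * ‖Mt ν w + I‖ * ‖1 + sqb (rectC G (Ht l ν w))‖ ^ 2 := by
        calc ‖Mt ν w + rectC G (Ht l ν w)‖ + 1 ≤ ‖Mt ν w‖ + ‖rectC G (Ht l ν w)‖ + 1 := by
              gcongr; exact norm_add_le _ _
          _ ≤ (‖Mt ν w‖ + 1) * (1 + ‖rectC G (Ht l ν w)‖) := by nlinarith
          _ ≤ _ := by gcongr; linarith
      calc _ ≤ (2 * ‖Mt ν w + I‖ * ‖1 + sqb (rectC G (Ht l ν w))‖ ^ 2) ^ 2 := by gcongr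
        _ = _ := by ring
  have homc : ContinuousOn (om l G ρ) UHP := fun z hz =>
    (om_diffAt hl ρ (UHP_sub_SS hz) (hS z hz).1).continuousAt.continuousWithinAt
  have hE := lemE (x := x) (g := om l G ρ)
    (P := fun w => w * Tfun l (Mt ν w) - x * Tfun l (Mt ν w + rectC G (Ht l ν w)))
    (W := fun w => ‖Tfun l (Mt ν w + rectC G (Ht l ν w))‖)
    (N := fun w => ((w + I) * (Mt ν w + I) ^ 2 * (1 + sqb (rectC G (Ht l ν w))) ^ 4)⁻¹)
    (e := fun z => ‖z - x‖) homc (fun z hz => UHP_sub_SS (hS z hz).2.1) hP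
    (by
      intro w hw
      rw [hconjT, Mt_conj, T_conj, ← norm_conj (w * Tfun l (Mt ν w) - _)]
      simp only [map_sub, map_mul, conj_ofReal])
    hd2.continuousOn.norm
    (by
      intro w hw
      simp only [hconjT, norm_conj])
    (fun w hw => norm_nonneg _)
    (by
      apply DifferentiableOn.inv
      · apply DifferentiableOn.mul
        · apply DifferentiableOn.mul
          · fun_prop
          · exact (((Mt_diff ν).mono UHP_sub_SS).add_const _).pow 2
        · apply DifferentiableOn.pow
          apply DifferentiableOn.const_add
          intro w hw
          exact ((sqb_diffAt (hCS w hw)).comp w (hCH.differentiableAt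
            (SS_open.mem_nhds (UHP_sub_SS hw)))).differentiableWithinAt
      · exact hden0)
    (fun w hw => inv_ne_zero (hden0 w hw))
    (4 * (1 + x))
    (by
      intro w hw
      rw [norm_inv, ← div_eq_mul_inv, div_le_iff₀ (norm_pos_iff.2 (hden0 w hw))]
      obtain ⟨k1, k2⟩ := key w hw
      obtain ⟨a1, a2⟩ := norm_add_I (le_of_lt hw : 0 ≤ w.im)
      obtain ⟨b1, b2⟩ := sqb_bound (hCS w hw)
      have b4 : 1 ≤ ‖1 + sqb (rectC G (Ht l ν w))‖ ^ 4 := one_le_pow₀ b2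
      refine (norm_sub_le _ _).trans ?_
      simp only [norm_mul, norm_pow, norm_real, Real.norm_of_nonneg hx.le]
      set A := ‖Mt ν w + I‖ ^ 2
      set B := ‖1 + sqb (rectC G (Ht l ν w))‖ ^ 4
      have hA : 0 ≤ A := by positivity
      calc _ ≤ ‖w + I‖ * (4 * A * B) + x * (‖w + I‖ * (4 * A * B)) := by
            gcongr
            · refine k1.trans ?_
              nlinarith
            · refine k2.trans ?_
              have : 0 ≤ 4 * A * B := by positivity
              nlinarith
        _ = _ := by ring)
    (by
      intro w hw
      rw [norm_inv, ← div_eq_mul_inv, div_le_iff₀ (norm_pos_iff.2 (hden0 w hw))]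
      obtain ⟨k1, k2⟩ := key w hw
      obtain ⟨a1, a2⟩ := norm_add_I (le_of_lt hw : 0 ≤ w.im)
      simp only [norm_mul, norm_pow]
      refine k2.trans ?_
      set A := ‖Mt ν w + I‖ ^ 2
      set B := ‖1 + sqb (rectC G (Ht l ν w))‖ ^ 4
      have hAB : 0 ≤ A * B := by positivity
      have h5 : A * B ≤ ‖w + I‖ * (A * B) := by nlinarith
      have h6 : 0 ≤ x * (‖w + I‖ * (A * B)) := by positivity
      nlinarith)
    (by
      have : Tendsto (fun z : ℂ => ‖z - x‖) (𝓝 (x : ℂ)) (𝓝 ‖(x : ℂ) - x‖) :=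
        Continuous.tendsto (by fun_prop) _
      rw [sub_self, norm_zero] at this
      exact this.mono_left nhdsWithin_le_nhds)
    (by
      filter_upwards [self_mem_nhdsWithin] with z hz
      obtain ⟨s1, s2, s3⟩ := hS z hz
      have e1 : om l G ρ z * Tfun l (mp l G ρ z) = Ht l ρ z := by
        rw [om, div_mul_cancel₀ _ s1]
      have e2 : Ht l ν (om l G ρ z) = Ht l ρ z := by rw [Ht_eq, s3, e1]
      have e3 : mp l G ρ z + rectC G (Ht l ρ z) = Mt ρ z := by rw [mp]; ring
      simp only [e2, s3, e3, e1]
      rw [Ht_eq, ← sub_mul, norm_mul])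
  rcases hE with h | h
  · exact h
  exfalso
  have hid : Tendsto (fun w : ℝ => (w : ℂ)) (𝓝[<] 0) (𝓝 0) := by
    have := (continuous_ofReal.tendsto 0).mono_left (nhdsWithin_le_nhds (s := Iio (0:ℝ)))
    simpa using this
  have t1 : Tendsto (fun w : ℝ => (w : ℂ) * Tfun l (Mt ν w)
      - x * Tfun l (Mt ν w + rectC G (Ht l ν w))) (𝓝[<] 0)
      (𝓝 (0 * Tfun l 0 - x * Tfun l (0 + 0))) := by
    have hT := (Tfun_diff l).continuous
    exact (hid.mul ((hT.tendsto _).comp (Mt_tendsto ν))).sub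
      (((hT.tendsto _).comp ((Mt_tendsto ν).add (CH_tendsto hl G ν))).const_mul _)
  have t2 := tendsto_nhds_unique (t1.congr' (f₂ := fun _ => (0:ℂ)) (by
    filter_upwards [self_mem_nhdsWithin] with w hw
    exact h w (neg_mem_SS hw))) tendsto_const_nhds
  simp [Tfun] at t2
  exact hx.ne' t2

lemma H_limit_gen {l : ℝ} (hl : l ∈ Ioo (0 : ℝ) 1) {G : Measure ℝ} [IsFiniteMeasure G] (h0 : G ≠ 0)
    (ρ : Measure ℝ) [IsProbabilityMeasure ρ] (x : ℝ)
    (α β γ δ : ℝ) (α' β' γ' δ' : ℂ → ℂ)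
    (tα : Tendsto α' (𝓝[UHP] (x : ℂ)) (𝓝 (α : ℂ))) (tβ : Tendsto β' (𝓝[UHP] (x : ℂ)) (𝓝 (β : ℂ)))
    (tγ : Tendsto γ' (𝓝[UHP] (x : ℂ)) (𝓝 (γ : ℂ))) (tδ : Tendsto δ' (𝓝[UHP] (x : ℂ)) (𝓝 (δ : ℂ)))
    (hq : ∀ᶠ z in 𝓝[UHP] (x : ℂ), α' z * Ht l ρ z ^ 2 + β' z * rectC G (Ht l ρ z) ^ 4
      - γ' z * rectC G (Ht l ρ z) ^ 2 * Ht l ρ z - δ' z * rectC G (Ht l ρ z) ^ 2 = 0)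
    (hne : ∃ h : ℝ, h < 0 ∧ ∀ c : ℝ, c < 0 →
      α * h ^ 2 + β * c ^ 4 - γ * c ^ 2 * h - δ * c ^ 2 ≠ 0) :
    ∃ L : OnePoint ℂ, Tendsto (fun z => (Ht l ρ z : OnePoint ℂ)) (𝓝[UHP] (x : ℂ)) (𝓝 L) := by
  have hden0 : ∀ w ∈ UHP, (w + I) ^ 2 * (rectC G w + I) ^ 4 ≠ 0 := fun w hw =>
    mul_ne_zero (pow_ne_zero _ (add_I_ne (le_of_lt hw)))
      (pow_ne_zero _ (add_I_ne (rectC_im_pos h0 hw).le))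
  -- the basic bound on the four monomials
  have mono : ∀ (a b c d : ℂ) (w : ℂ), ‖a * w ^ 2 + b * rectC G w ^ 4
      - c * rectC G w ^ 2 * w - d * rectC G w ^ 2‖ ≤
      (‖a‖ + ‖b‖ + ‖c‖ + ‖d‖) * ((1 + ‖w‖) ^ 2 * (1 + ‖rectC G w‖) ^ 4) := by
    intro a b c d w
    set C := rectC G w
    have hw := norm_nonneg w
    have hC := norm_nonneg C
    have w2 : ‖w‖ ^ 2 ≤ (1 + ‖w‖) ^ 2 := by gcongr; linarith
    have w1 : ‖w‖ ≤ (1 + ‖w‖) ^ 2 := by nlinarith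
    have w0 : 1 ≤ (1 + ‖w‖) ^ 2 := by nlinarith
    have c4 : ‖C‖ ^ 4 ≤ (1 + ‖C‖) ^ 4 := by gcongr; linarith
    have c2' : ‖C‖ ^ 2 ≤ (1 + ‖C‖) ^ 2 := by gcongr; linarith
    have c0' : (1:ℝ) ≤ (1 + ‖C‖) ^ 2 := by nlinarith
    have c2 : ‖C‖ ^ 2 ≤ (1 + ‖C‖) ^ 4 := by nlinarith
    have c0 : (1:ℝ) ≤ (1 + ‖C‖) ^ 4 := by nlinarith
    set R := (1 + ‖w‖) ^ 2
    set S := (1 + ‖C‖) ^ 4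
    have t1 : ‖w‖ ^ 2 ≤ R * S := by
      calc ‖w‖ ^ 2 = ‖w‖ ^ 2 * 1 := by ring
        _ ≤ R * S := by gcongr
    have t2 : ‖C‖ ^ 4 ≤ R * S := by
      calc ‖C‖ ^ 4 = 1 * ‖C‖ ^ 4 := by ring
        _ ≤ R * S := by gcongr
    have t3 : ‖C‖ ^ 2 * ‖w‖ ≤ R * S := by
      calc ‖C‖ ^ 2 * ‖w‖ = ‖w‖ * ‖C‖ ^ 2 := by ring
        _ ≤ R * S := by gcongr
    have t4 : ‖C‖ ^ 2 ≤ R * S := by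
      calc ‖C‖ ^ 2 = 1 * ‖C‖ ^ 2 := by ring
        _ ≤ R * S := by gcongr
    calc _ ≤ ‖a * w ^ 2‖ + ‖b * C ^ 4‖ + ‖c * C ^ 2 * w‖ + ‖d * C ^ 2‖ := by
          refine (norm_sub_le _ _).trans ?_
          gcongr
          refine (norm_sub_le _ _).trans ?_
          gcongr
          exact norm_add_le _ _
      _ = ‖a‖ * ‖w‖ ^ 2 + ‖b‖ * ‖C‖ ^ 4 + ‖c‖ * (‖C‖ ^ 2 * ‖w‖) + ‖d‖ * ‖C‖ ^ 2 := by
          simp only [norm_mul, norm_pow]; ring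
      _ ≤ ‖a‖ * (R * S) + ‖b‖ * (R * S) + ‖c‖ * (R * S) + ‖d‖ * (R * S) := by gcongr
      _ = _ := by ring
  have bd : ∀ w ∈ UHP, (1 + ‖w‖) ^ 2 * (1 + ‖rectC G w‖) ^ 4 ≤
      64 * ‖(w + I) ^ 2 * (rectC G w + I) ^ 4‖ := by
    intro w hw
    obtain ⟨a1, a2⟩ := norm_add_I (le_of_lt hw : 0 ≤ w.im)
    obtain ⟨b1, b2⟩ := norm_add_I (rectC_im_pos h0 hw).le
    rw [norm_mul, norm_pow, norm_pow]
    calc _ ≤ (2 * ‖w + I‖) ^ 2 * (2 * ‖rectC G w + I‖) ^ 4 := by gcongr <;> linarith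
      _ = _ := by ring
  set K : ℝ := ‖(α : ℂ)‖ + ‖(β : ℂ)‖ + ‖(γ : ℂ)‖ + ‖(δ : ℂ)‖ with hK
  have hK0 : 0 ≤ K := by positivity
  have hCd := rectC_diff G
  have hE := lemE (x := x) (g := Ht l ρ)
    (P := fun w => α * w ^ 2 + β * rectC G w ^ 4 - γ * rectC G w ^ 2 * w - δ * rectC G w ^ 2)
    (W := fun w => (1 + ‖w‖) ^ 2 * (1 + ‖rectC G w‖) ^ 4)
    (N := fun w => ((w + I) ^ 2 * (rectC G w + I) ^ 4)⁻¹)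
    (e := fun z => ‖(α : ℂ) - α' z‖ + ‖(β : ℂ) - β' z‖ + ‖(γ : ℂ) - γ' z‖ + ‖(δ : ℂ) - δ' z‖)
    ((Ht_diff l ρ).continuousOn.mono UHP_sub_SS)
    (fun z hz => Ht_SS hl ρ (UHP_sub_SS hz))
    (by
      exact (((differentiableOn_id.pow 2).const_mul _).add ((hCd.pow 4).const_mul _)).sub
        (((hCd.pow 2).const_mul _).mul differentiableOn_id) |>.sub ((hCd.pow 2).const_mul _))
    (by
      intro w hw
      rw [rectC_conj, ← norm_conj ((α : ℂ) * w ^ 2 + _ - _ - _)]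
      simp only [map_sub, map_add, map_mul, map_pow, conj_ofReal])
    (by
      exact ((continuousOn_const.add continuousOn_id.norm).pow 2).mul
        ((continuousOn_const.add hCd.continuousOn.norm).pow 4))
    (by
      intro w hw
      simp only [rectC_conj, norm_conj])
    (fun w hw => by positivity)
    (by
      apply DifferentiableOn.inv
      · apply DifferentiableOn.mul
        · fun_prop
        · exact ((hCd.mono UHP_sub_SS).add_const _).pow 4
      · exact hden0)
    (fun w hw => inv_ne_zero (hden0 w hw))
    (64 * (K + 1))
    (by
      intro w hw
      rw [norm_inv, ← div_eq_mul_inv, div_le_iff₀ (norm_pos_iff.2 (hden0 w hw))]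
      refine (mono _ _ _ _ w).trans ?_
      have := bd w hw
      have h1 : 0 ≤ ‖(w + I) ^ 2 * (rectC G w + I) ^ 4‖ := norm_nonneg _
      calc _ ≤ K * (64 * ‖(w + I) ^ 2 * (rectC G w + I) ^ 4‖) := by gcongr
        _ ≤ _ := by nlinarith)
    (by
      intro w hw
      rw [norm_inv, ← div_eq_mul_inv, div_le_iff₀ (norm_pos_iff.2 (hden0 w hw))]
      have := bd w hw
      have h1 : 0 ≤ ‖(w + I) ^ 2 * (rectC G w + I) ^ 4‖ := norm_nonneg _
      refine this.trans ?_
      nlinarith [mul_nonneg hK0 h1])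
    (by
      have := (((tα.const_sub (α : ℂ)).norm.add (tβ.const_sub (β : ℂ)).norm).add
        (tγ.const_sub (γ : ℂ)).norm).add (tδ.const_sub (δ : ℂ)).norm
      simpa using this)
    (by
      filter_upwards [hq] with z hz
      have := mono ((α : ℂ) - α' z) ((β : ℂ) - β' z) ((γ : ℂ) - γ' z) ((δ : ℂ) - δ' z) (Ht l ρ z)
      refine le_trans (le_of_eq ?_) this
      congr 1
      linear_combination hz)
  rcases hE with h | h
  · exact h
  exfalso
  obtain ⟨w, hw, hcw⟩ := hne
  obtain ⟨c, e, hc⟩ := rectC_neg h0 hw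
  have := h w (neg_mem_SS hw)
  simp only [e] at this
  exact hcw c hc (by exact_mod_cast this)

lemma H_limit_abs {l : ℝ} (hl : l ∈ Ioo (0 : ℝ) 1) {G : Measure ℝ} [IsFiniteMeasure G] (h0 : G ≠ 0)
    (ρ : Measure ℝ) [IsProbabilityMeasure ρ] {x : ℝ} (hx : 0 < x)
    (hD : ∀ z ∈ UHP, Tfun l (mp l G ρ z) ≠ 0)
    (b₀ s₀ : ℝ) (b s : ℂ → ℂ)
    (tb : Tendsto b (𝓝[UHP] (x : ℂ)) (𝓝 (b₀ : ℂ))) (ts : Tendsto s (𝓝[UHP] (x : ℂ)) (𝓝 (s₀ : ℂ)))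
    (hbs : ∀ z ∈ UHP, b z * om l G ρ z = s z)
    (hbs0 : (0 ≤ b₀ ∧ s₀ = 1) ∨ (b₀ = 1 ∧ s₀ = 0)) :
    ∃ L : OnePoint ℂ, Tendsto (fun z => (Ht l ρ z : OnePoint ℂ)) (𝓝[UHP] (x : ℂ)) (𝓝 L) := by
  have hxc : (x : ℂ) ≠ 0 := by exact_mod_cast hx.ne'
  have ta : Tendsto (fun z : ℂ => z⁻¹) (𝓝[UHP] (x : ℂ)) (𝓝 ((x⁻¹ : ℝ) : ℂ)) := by
    push_cast
    exact (tendsto_inv₀ hxc).mono_left nhdsWithin_le_nhds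
  have hl0 := hl.1
  have hl1 := hl.2
  refine H_limit_gen hl h0 ρ x ((s₀ * x⁻¹ - b₀) ^ 2) (l ^ 2 * s₀ ^ 2)
    (2 * l * s₀ * (s₀ * x⁻¹ + b₀)) (s₀ ^ 2 * (1 - l) ^ 2)
    (fun z => (s z * z⁻¹ - b z) ^ 2) (fun z => (l : ℂ) ^ 2 * s z ^ 2)
    (fun z => 2 * l * s z * (s z * z⁻¹ + b z)) (fun z => s z ^ 2 * (1 - l) ^ 2) ?_ ?_ ?_ ?_ ?_ ?_
  · have := ((ts.mul ta).sub tb).pow 2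
    exact_mod_cast this
  · have := (ts.pow 2).const_mul ((l : ℂ) ^ 2)
    exact_mod_cast this
  · have := (ts.const_mul (2 * l : ℂ)).mul ((ts.mul ta).add tb)
    exact_mod_cast this
  · have := (ts.pow 2).mul_const ((1 - l : ℂ) ^ 2)
    exact_mod_cast this
  · filter_upwards [self_mem_nhdsWithin] with z hz
    have hz0 : z ≠ 0 := by
      rintro rfl
      simp [UHP] at hz
    have e1 : om l G ρ z * Tfun l (mp l G ρ z) = Ht l ρ z := by
      rw [om, div_mul_cancel₀ _ (hD z hz)]
    have ec : rectC G (Ht l ρ z) = Mt ρ z - mp l G ρ z := by rw [mp]; ring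
    have ha : z⁻¹ * Ht l ρ z = Tfun l (Mt ρ z) := by
      rw [Ht_eq, ← mul_assoc, inv_mul_cancel₀ hz0, one_mul]
    have hb : b z * Ht l ρ z = s z * Tfun l (mp l G ρ z) := by
      rw [← e1, ← mul_assoc, hbs z hz]
    rw [ec]
    generalize Mt ρ z = M at *
    generalize mp l G ρ z = m at *
    generalize Ht l ρ z = h at *
    have r : (s z * z⁻¹ - b z) ^ 2 * h ^ 2 + (l : ℂ) ^ 2 * s z ^ 2 * (M - m) ^ 4
        - 2 * l * s z * (s z * z⁻¹ + b z) * (M - m) ^ 2 * h - s z ^ 2 * (1 - l) ^ 2 * (M - m) ^ 2 =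
        (s z * (z⁻¹ * h) - b z * h) ^ 2 + (l : ℂ) ^ 2 * s z ^ 2 * (M - m) ^ 4
        - 2 * l * s z * (s z * (z⁻¹ * h) + b z * h) * (M - m) ^ 2
        - s z ^ 2 * (1 - l) ^ 2 * (M - m) ^ 2 := by ring
    rw [r, ha, hb, Tfun, Tfun]
    ring
  · rcases hbs0 with ⟨hb, rfl⟩ | ⟨rfl, rfl⟩
    · have hxi : 0 < x⁻¹ := inv_pos.2 hx
      have hg : 0 < 2 * l * 1 * (1 * x⁻¹ + b₀) := by positivity
      set g := 2 * l * 1 * (1 * x⁻¹ + b₀)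
      refine ⟨-(1 / g), by simp [hg], fun c hc => ?_⟩
      have e : g * c ^ 2 * (-(1 / g)) = - c ^ 2 := by field_simp
      rw [e]
      have hc2 : 0 < c ^ 2 := by nlinarith
      have h1 : 1 ^ 2 * (1 - l) ^ 2 * c ^ 2 < c ^ 2 := by
        have h4 : (1 - l) ^ 2 < 1 := by nlinarith
        nlinarith
      have h2 : 0 ≤ (1 * x⁻¹ - b₀) ^ 2 * (-(1 / g)) ^ 2 := by positivity
      have h3 : 0 ≤ l ^ 2 * 1 ^ 2 * c ^ 4 := by positivity
      intro h
      linarith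
    · exact ⟨-1, by norm_num, fun c hc => by norm_num⟩

lemma H_limit {l : ℝ} (hl : l ∈ Ioo (0 : ℝ) 1) {G : Measure ℝ} [IsFiniteMeasure G] (h0 : G ≠ 0)
    (ρ : Measure ℝ) [IsProbabilityMeasure ρ] (ν : Measure ℝ) [IsProbabilityMeasure ν]
    (hS : ∀ z ∈ UHP, Tfun l (mp l G ρ z) ≠ 0 ∧ om l G ρ z ∈ UHP ∧
      Mt ν (om l G ρ z) = mp l G ρ z) {x : ℝ} (hx : 0 < x) :
    ∃ L : OnePoint ℂ, Tendsto (fun z => (Ht l ρ z : OnePoint ℂ)) (𝓝[UHP] (x : ℂ)) (𝓝 L) := by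
  have hD := fun z hz => (hS z hz).1
  have hom0 : ∀ z ∈ UHP, om l G ρ z ≠ 0 := by
    intro z hz h
    have := (hS z hz).2.1
    rw [h] at this
    simp [UHP] at this
  obtain ⟨L, hL⟩ := om_limit hl h0 ρ ν hS hx
  induction L using OnePoint.rec with
  | infty =>
    have t : Tendsto (om l G ρ) (𝓝[UHP] (x : ℂ)) (Bornology.cobounded ℂ) := by
      rw [Metric.cobounded_eq_cocompact, ← coclosedCompact_eq_cocompact,
        ← OnePoint.comap_coe_nhds_infty, tendsto_comap_iff]
      exact hL
    refine H_limit_abs hl h0 ρ hx hD 0 1 (fun z => (om l G ρ z)⁻¹) (fun _ => 1) ?_ ?_ ?_ ?_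
    · simpa [Function.comp_def] using tendsto_inv₀_cobounded.comp t
    · simp
    · intro z hz; exact inv_mul_cancel₀ (hom0 z hz)
    · simp
  | coe L =>
    have t : Tendsto (om l G ρ) (𝓝[UHP] (x : ℂ)) (𝓝 L) :=
      OnePoint.isOpenEmbedding_coe.tendsto_nhds_iff.2 hL
    by_cases hLS : L ∈ SS
    · refine ⟨(Ht l ν L : ℂ), ?_⟩
      apply (OnePoint.continuous_coe.tendsto _).comp
      have c : ContinuousAt (Ht l ν) L :=
        ((Ht_diff l ν).differentiableAt (SS_open.mem_nhds hLS)).continuousAt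
      refine (c.tendsto.comp t).congr' ?_
      filter_upwards [self_mem_nhdsWithin] with z hz
      obtain ⟨s1, s2, s3⟩ := hS z hz
      have e1 : om l G ρ z * Tfun l (mp l G ρ z) = Ht l ρ z := by
        rw [om, div_mul_cancel₀ _ s1]
      simp only [Function.comp]
      rw [Ht_eq, s3, e1]
    · have hre : 0 ≤ L.re ∧ L.im = 0 := by
        simp only [SS, mem_ofPred_eq] at hLS
        push Not at hLS
        exact hLS
      have eL : L = (L.re : ℂ) := Complex.ext (by simp) (by simp [hre.2])
      by_cases hL0 : L = 0
      · refine H_limit_abs hl h0 ρ hx hD 1 0 (fun _ => 1) (om l G ρ) ?_ ?_ ?_ ?_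
        · simp
        · simpa [hL0] using t
        · intro z hz; simp
        · simp
      · refine H_limit_abs hl h0 ρ hx hD (L.re)⁻¹ 1 (fun z => (om l G ρ z)⁻¹) (fun _ => 1) ?_ ?_ ?_ ?_
        · have := t.inv₀ hL0
          rw [eL] at this
          push_cast
          exact this
        · simp
        · intro z hz; exact inv_mul_cancel₀ (hom0 z hz)
        · left; exact ⟨inv_nonneg.2 hre.1, rfl⟩

lemma M_limit {l : ℝ} (hl : l ∈ Ioo (0 : ℝ) 1)
    (ρ : Measure ℝ) [IsProbabilityMeasure ρ] {x : ℝ} (hx : 0 < x)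
    (hH : ∃ L : OnePoint ℂ, Tendsto (fun z => (Ht l ρ z : OnePoint ℂ)) (𝓝[UHP] (x : ℂ)) (𝓝 L)) :
    ∃ L : OnePoint ℂ, Tendsto (fun z => (Mt ρ z : OnePoint ℂ)) (𝓝[UHP] (x : ℂ)) (𝓝 L) := by
  by_contra hno
  obtain ⟨L, hL⟩ := hH
  have hxc : (x : ℂ) ≠ 0 := by exact_mod_cast hx.ne'
  have hlc : (l : ℂ) ≠ 0 := by exact_mod_cast hl.1.ne'
  have hcl : ∀ a, MapClusterPt a (𝓝[UHP] (x : ℂ)) (Mt ρ) →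
      L = ((x * Tfun l a : ℂ) : OnePoint ℂ) := by
    intro a ha
    obtain ⟨F, hF, hFl, hFt⟩ := cluster_filter ha
    have hid : Tendsto (fun z : ℂ => z) F (𝓝 (x : ℂ)) := hFl.trans nhdsWithin_le_nhds
    have t : Tendsto (fun z => Ht l ρ z) F (𝓝 (x * Tfun l a)) := by
      refine (hid.mul (((Tfun_diff l).continuous.tendsto a).comp hFt)).congr ?_
      intro z
      exact (Ht_eq l ρ z).symm
    exact tendsto_nhds_unique (hL.mono_left hFl) ((OnePoint.continuous_coe.tendsto _).comp t)
  obtain ⟨a, ha⟩ := exists_cluster hno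
  obtain ⟨D, hD, hs⟩ := cluster_sphere x ((Mt_diff ρ).continuousOn.mono UHP_sub_SS) hno a ha
  obtain ⟨a1, h1, c1⟩ := hs D hD le_rfl
  obtain ⟨a2, h2, c2⟩ := hs (D / 2) (by positivity) (by linarith)
  have hT : ∀ b, L = ((x * Tfun l b : ℂ) : OnePoint ℂ) → b - a ≠ 0 →
      l * (b + a) + 1 + l = 0 := by
    intro b hb hba
    have e := (hcl a ha).symm.trans hb
    have e2 := mul_left_cancel₀ hxc (OnePoint.coe_injective e)
    simp only [Tfun] at e2
    have : (b - a) * (l * (b + a) + 1 + l) = 0 := by linear_combination -e2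
    exact (mul_eq_zero.1 this).resolve_left hba
  have r1 := hT a1 (hcl a1 c1) (by rw [← norm_pos_iff, h1]; exact hD)
  have r2 := hT a2 (hcl a2 c2) (by rw [← norm_pos_iff, h2]; positivity)
  have : a1 = a2 := by
    have : (l : ℂ) * (a1 - a2) = 0 := by linear_combination r1 - r2
    exact sub_eq_zero.1 ((mul_eq_zero.1 this).resolve_left hlc)
  rw [this, h2] at h1
  linarith

theorem stmt14 (l : ℝ) (hl : l ∈ Set.Ioo (0 : ℝ) 1)
    (μ : Measure ℝ) [IsProbabilityMeasure μ] (hμ0 : μ ≠ Measure.dirac (0 : ℝ))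
    (hμsym : Measure.map (fun t : ℝ => -t) μ = μ)
    (G : Measure ℝ) [IsFiniteMeasure G]
    (hGsym : Measure.map (fun t : ℝ => -t) G = G)
    (hID : IsRectInfDiv l μ G)
    (ν ρ : Measure ℝ) [IsProbabilityMeasure ν] [IsProbabilityMeasure ρ]
    (hνsym : Measure.map (fun t : ℝ => -t) ν = ν)
    (hρsym : Measure.map (fun t : ℝ => -t) ρ = ρ)
    (hconv : IsRectConv l G ν ρ) :
    ∀ x : ℝ, 0 < x →
      (∃ L : OnePoint ℂ,
        Tendsto (fun z : ℂ => ((Mt ρ z : ℂ) : OnePoint ℂ)) (nhdsWithin (x : ℂ) UHP)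
          (nhds L) ∧
        (L = OnePoint.infty ∨ ∃ w : ℂ, L = (w : OnePoint ℂ) ∧ 0 ≤ w.im)) ∧
      (∃ L' : OnePoint ℂ,
        Tendsto (fun z : ℂ => ((Ht l ρ z : ℂ) : OnePoint ℂ)) (nhdsWithin (x : ℂ) UHP)
          (nhds L')) := by
  intro x hx
  have h0 : G ≠ 0 := G_ne_zero hl μ hμ0 G hID
  rcases Mt_dichotomy ρ with hM | hM
  · refine ⟨⟨((0 : ℂ) : OnePoint ℂ), ?_, Or.inr ⟨0, rfl, by simp⟩⟩, ((x : ℂ) : OnePoint ℂ), ?_⟩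
    · simp only [hM]
      exact tendsto_const_nhds
    · have : ∀ z, Ht l ρ z = z := fun z => by simp [Ht, hM]
      simp only [this]
      exact (OnePoint.continuous_coe.tendsto _).mono_left nhdsWithin_le_nhds
  · have hS := subord hl h0 ρ ν hconv hM
    have hH := H_limit hl h0 ρ ν hS hx
    refine ⟨?_, hH⟩
    obtain ⟨L, hL⟩ := M_limit hl ρ hx hH
    refine ⟨L, hL, ?_⟩
    induction L using OnePoint.rec with
    | infty => exact Or.inl rfl
    | coe w =>
      refine Or.inr ⟨w, rfl, ?_⟩
      have t : Tendsto (Mt ρ) (𝓝[UHP] (x : ℂ)) (𝓝 w) :=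
        OnePoint.isOpenEmbedding_coe.tendsto_nhds_iff.2 hL
      refine ge_of_tendsto ((continuous_im.tendsto _).comp t) ?_
      filter_upwards [self_mem_nhdsWithin] with z hz
      exact Mt_im_nonneg ρ hz

end
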